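/- arXiv:1205.2268 — 3 statements merged into one kernel-verified Lean document; each statement's English description precedes it below -/
import Mathlib

section
/- Let α > −1/2, b > 0, and let f ∈ L¹_α(ℝ⁺) be such that ℱ_α(f) vanishes outside [0,b]. Then f agrees on ℝ⁺ with an even entire function, and, with the operator D defined on even entire functions by (Dh)(z) = h′(z)/(2z), for every integer k ≥ 0 one has (∫_0^∞ |D^k f(x)|² dμ_{α+k}(x))^{1/2} ≤ √(Γ(α+1)/Γ(α+k+1)) · (π^{3/2} b)^k · (∫_0^∞ |f(x)|² dμ_α(x))^{1/2} (Bernstein's inequality for the Fourier–Bessel transform). -/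
open MeasureTheory Real Set

/-- The measure `dμ_α(x) = (2π^{α+1}/Γ(α+1)) x^{2α+1} dx` on `ℝ⁺ = [0,∞)`. -/
noncomputable def muB (α : ℝ) : Measure ℝ :=
  (volume.restrict (Set.Ici (0:ℝ))).withDensity
    (fun x => ENNReal.ofReal (2 * π ^ (α+1) / Gamma (α+1) * x ^ (2*α+1)))

/-- The normalized Bessel function `j_α`. -/
noncomputable def besselJ (α : ℝ) (x : ℝ) : ℝ :=
  Gamma (α+1) * ∑' n : ℕ,
    ((-1:ℝ)^n / ((n.factorial : ℝ) * Gamma ((n:ℝ) + α + 1))) * (x/2)^(2*n)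

/-- The Fourier-Bessel (Hankel) transform of `f ∈ L¹_α(ℝ⁺)`. -/
noncomputable def fourierBessel (α : ℝ) (f : ℝ → ℂ) (y : ℝ) : ℂ :=
  ∫ x, f x * (besselJ α (2*π*x*y) : ℂ) ∂(muB α)


namespace FourierBessel

/-- The Taylor coefficients of `w ↦ j_α(2√w)`. -/
noncomputable def besselCoeff (α : ℝ) (n : ℕ) : ℝ :=
  Gamma (α + 1) * ((-1) ^ n / ((n.factorial : ℝ) * Gamma ((n : ℝ) + α + 1)))

/-- The entire function `w ↦ j_α(2√w)`. -/
noncomputable def besselE (α : ℝ) (w : ℂ) : ℂ :=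
  ∑' n : ℕ, (besselCoeff α n : ℂ) * w ^ n

variable {α : ℝ}

lemma gamma_add_one_pos (hα : -1/2 < α) : 0 < Gamma (α + 1) :=
  Gamma_pos_of_pos (by linarith)

lemma gamma_nat_add_pos (hα : -1/2 < α) (n : ℕ) : 0 < Gamma ((n : ℝ) + α + 1) :=
  Gamma_pos_of_pos (by have := n.cast_nonneg (α := ℝ); linarith)

@[simp]
lemma besselCoeff_zero (hα : -1/2 < α) : besselCoeff α 0 = 1 := by
  have := (gamma_add_one_pos hα).ne'
  simp [besselCoeff, this]

lemma besselCoeff_succ (hα : -1/2 < α) (n : ℕ) :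
    (n + 1) * besselCoeff α (n + 1) = -(1 / (α + 1)) * besselCoeff (α + 1) n := by
  have h1 : α + 1 ≠ 0 := by linarith
  have h2 := (gamma_nat_add_pos (α := α + 1) (by linarith) n).ne'
  have h3 : ((n + 1 : ℕ) : ℝ) + α + 1 = n + (α + 1) + 1 := by push_cast; ring
  have h4 : (n : ℝ) + 1 ≠ 0 := by positivity
  rw [besselCoeff, besselCoeff, h3, Gamma_add_one h1, Nat.factorial_succ, pow_succ]
  push_cast
  field_simp

lemma besselCoeff_eq_add_one (hα : -1/2 < α) (n : ℕ) :
    (α + 1) * besselCoeff α n = (n + α + 1) * besselCoeff (α + 1) n := by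
  have h1 : α + 1 ≠ 0 := by linarith
  have h2 := (gamma_nat_add_pos hα n).ne'
  have h4 : (n : ℝ) + α + 1 ≠ 0 := by have := n.cast_nonneg (α := ℝ); linarith
  rw [besselCoeff, besselCoeff, Gamma_add_one h1,
    show (n : ℝ) + (α + 1) + 1 = (n + α + 1) + 1 by ring, Gamma_add_one h4]
  field_simp

lemma abs_besselCoeff_le (hα : -1/2 < α) (n : ℕ) :
    |besselCoeff α n| ≤ 2 ^ n / n.factorial := by
  induction n generalizing α with
  | zero => simp [hα]
  | succ n ih =>
    have h := besselCoeff_succ hα n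
    have h1 : 0 < α + 1 := by linarith
    have h2 : 1 / (α + 1) ≤ 2 := by rw [div_le_iff₀ h1]; linarith
    have h3 : (0 : ℝ) < n + 1 := by positivity
    have h4 := congrArg abs h
    rw [abs_mul, abs_mul, abs_neg, abs_of_pos h3,
      abs_of_pos (one_div_pos.2 h1)] at h4
    have h5 : (n + 1) * |besselCoeff α (n + 1)| ≤ 2 * (2 ^ n / n.factorial) := by
      rw [h4]; gcongr; exact ih (by linarith)
    rw [Nat.factorial_succ, pow_succ]
    push_cast
    rw [← mul_le_mul_iff_right₀ h3]
    refine h5.trans (le_of_eq ?_)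
    field_simp

lemma norm_besselE_term_le (hα : -1/2 < α) (w : ℂ) (n : ℕ) :
    ‖(besselCoeff α n : ℂ) * w ^ n‖ ≤ (2 * ‖w‖) ^ n / n.factorial := by
  rw [norm_mul, norm_pow, Complex.norm_real, norm_eq_abs]
  calc _ ≤ 2 ^ n / n.factorial * ‖w‖ ^ n := by gcongr; exact abs_besselCoeff_le hα n
    _ = _ := by ring

lemma summable_besselE (hα : -1/2 < α) (w : ℂ) :
    Summable fun n : ℕ => (besselCoeff α n : ℂ) * w ^ n :=
  .of_norm_bounded (Real.summable_pow_div_factorial (2 * ‖w‖)) (norm_besselE_term_le hα w)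

lemma norm_besselE_le (hα : -1/2 < α) (w : ℂ) : ‖besselE α w‖ ≤ exp (2 * ‖w‖) := by
  rw [Real.exp_eq_exp_ℝ, NormedSpace.exp_eq_tsum_div]
  exact tsum_of_norm_bounded (Real.summable_pow_div_factorial (2 * ‖w‖)).hasSum
    (norm_besselE_term_le hα w)

lemma hasDerivAt_besselE (hα : -1/2 < α) (w : ℂ) :
    HasDerivAt (besselE α) (-(1 / (α + 1)) * besselE (α + 1) w) w := by
  have hα' : -1/2 < α + 1 := by linarith
  have h1 : 1 / (α + 1) ≤ 2 := by rw [div_le_iff₀] <;> linarith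
  have h1' : 0 < 1 / (α + 1) := by have : 0 < α + 1 := by linarith
                                   positivity
  set R := ‖w‖ + 1
  have hR : 0 ≤ R := by positivity
  set u : ℕ → ℝ := fun n => 2 * ((2 * R) ^ (n - 1) / (n - 1).factorial) with hu
  have hterm (n : ℕ) (z : ℂ) : ((besselCoeff α (n + 1) : ℝ) : ℂ) * (((n + 1 : ℕ) : ℂ) * z ^ n) =
      -(1 / (α + 1)) * ((besselCoeff (α + 1) n : ℂ) * z ^ n) := by
    have := congrArg (fun x : ℝ => (x : ℂ)) (besselCoeff_succ hα n)
    push_cast at this ⊢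
    linear_combination z ^ n * this
  have hsu : Summable u := by
    rw [← summable_nat_add_iff 1]
    simpa [hu] using (Real.summable_pow_div_factorial (2 * R)).mul_left 2
  have key := hasDerivAt_tsum_of_isPreconnected (𝕜 := ℂ) (F := ℂ) (u := u)
    (g := fun n z => (besselCoeff α n : ℂ) * z ^ n)
    (g' := fun n z => (besselCoeff α n : ℂ) * (n * z ^ (n - 1)))
    (t := Metric.ball 0 R) (y₀ := 0) (y := w) hsu Metric.isOpen_ball
    (convex_ball _ _).isPreconnected
    (fun n z _ => (hasDerivAt_pow n z).const_mul _) ?_ (by simp [R]; positivity)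
    (summable_besselE hα 0) (by simp [R])
  · refine HasDerivAt.congr_deriv (f := besselE α) key ?_
    rw [tsum_eq_zero_add']
    · simp only [Nat.add_sub_cancel, hterm]
      rw [tsum_mul_left]; simp [besselE]
    · simp only [Nat.add_sub_cancel, hterm]
      exact (summable_besselE hα' w).mul_left _
  · rintro (_ | n) z hz
    · simp [hu]
    · simp only [Nat.add_sub_cancel, hterm, hu]
      rw [norm_mul]
      have hz' : ‖z‖ ≤ R := by simpa using (mem_ball_zero_iff.1 hz).le
      have : ‖(-(1 / ((α : ℂ) + 1)))‖ = 1 / (α + 1) := by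
        rw [norm_neg, show (1 / ((α : ℂ) + 1)) = ((1 / (α + 1) : ℝ) : ℂ) by push_cast; rfl,
          Complex.norm_real, norm_eq_abs, abs_of_pos h1']
      rw [this]
      refine mul_le_mul h1 ((norm_besselE_term_le hα' z n).trans ?_) (norm_nonneg _) (by norm_num)
      gcongr

lemma continuous_besselE (hα : -1/2 < α) : Continuous (besselE α) :=
  continuous_iff_continuousAt.2 fun w => (hasDerivAt_besselE hα w).continuousAt

/-- The Bessel equation for `besselE`, as a three-term contiguity relation. -/
lemma besselE_contiguity (hα : -1/2 < α) (w : ℂ) :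
    besselE α w = besselE (α + 1) w - w / ((α + 1) * (α + 2)) * besselE (α + 1 + 1) w := by
  have hα1 : -1/2 < α + 1 := by linarith
  have hα2 : -1/2 < α + 1 + 1 := by linarith
  have h1 : (α : ℂ) + 1 ≠ 0 := by
    have : α + 1 ≠ 0 := by linarith
    exact_mod_cast this
  have h2 : (α : ℂ) + 2 ≠ 0 := by
    have : α + 2 ≠ 0 := by linarith
    exact_mod_cast this
  have hw : w / ((α + 1) * (α + 2)) * besselE (α + 1 + 1) w =
      ∑' n : ℕ, w / ((α + 1) * (α + 2)) * ((besselCoeff (α + 1 + 1) n : ℂ) * w ^ n) := by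
    rw [tsum_mul_left]; rfl
  rw [hw, besselE, besselE, (summable_besselE hα w).tsum_eq_zero_add,
    (summable_besselE hα1 w).tsum_eq_zero_add, add_sub_assoc,
    ← Summable.tsum_sub ((summable_nat_add_iff 1).2 (summable_besselE hα1 w))
      ((summable_besselE hα2 w).mul_left _)]
  congr 1
  · simp [hα, hα1]
  · congr 1
    ext n
    have e1 := congrArg (fun x : ℝ => (x : ℂ)) (besselCoeff_succ hα1 n)
    have e2 := congrArg (fun x : ℝ => (x : ℂ)) (besselCoeff_eq_add_one hα (n + 1))
    push_cast at e1 e2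
    have h3 : (α : ℂ) + 1 + 1 ≠ 0 := by convert h2 using 1; ring
    have e1' : (besselCoeff (α + 1 + 1) n : ℂ)
        = -(α + 2) * (n + 1) * besselCoeff (α + 1) (n + 1) := by
      field_simp at e1
      linear_combination e1
    rw [e1']
    field_simp
    linear_combination w ^ (n + 1) * e2

lemma besselE_zero (hα : -1/2 < α) : besselE α 0 = 1 := by
  rw [besselE, tsum_eq_single 0]
  · simp [hα]
  · intro n hn; simp [hn]

/-- `|j_α| ≤ 1`, by monotonicity of the energy of the Bessel equation. -/
lemma abs_besselE_re_le_one (hα : -1/2 < α) {w : ℝ} (hw : 0 ≤ w) :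
    |(besselE α w).re| ≤ 1 := by
  have hα1 : -1/2 < α + 1 := by linarith
  have h1 : 0 < α + 1 := by linarith
  have h2 : 0 < α + 2 := by linarith
  set J : ℝ → ℝ := fun x => (besselE α x).re with hJ
  set J1 : ℝ → ℝ := fun x => (besselE (α + 1) x).re
  set J2 : ℝ → ℝ := fun x => (besselE (α + 1 + 1) x).re
  have dJ (x : ℝ) : HasDerivAt J (-(1 / (α + 1)) * J1 x) x := by
    have := (hasDerivAt_besselE hα (x : ℂ)).real_of_complex
    convert this using 1
    rw [show (-(1 / ((α : ℂ) + 1))) = ((-(1 / (α + 1)) : ℝ) : ℂ) by push_cast; rfl,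
      Complex.re_ofReal_mul]
  have dJ1 (x : ℝ) : HasDerivAt J1 (-(1 / (α + 2)) * J2 x) x := by
    have := (hasDerivAt_besselE hα1 (x : ℂ)).real_of_complex
    convert this using 1
    rw [show (-(1 / (((α + 1 : ℝ) : ℂ) + 1))) = ((-(1 / (α + 2)) : ℝ) : ℂ) by
      push_cast; ring, Complex.re_ofReal_mul]
  have hc (x : ℝ) : J x = J1 x - x / ((α + 1) * (α + 2)) * J2 x := by
    have := congrArg Complex.re (besselE_contiguity hα (x : ℂ))
    rw [Complex.sub_re, show ((x : ℂ) / ((α + 1) * (α + 2))) =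
      ((x / ((α + 1) * (α + 2)) : ℝ) : ℂ) by push_cast; rfl, Complex.re_ofReal_mul] at this
    exact this
  set E : ℝ → ℝ := fun x => J x ^ 2 + x / (α + 1) ^ 2 * J1 x ^ 2 with hE
  have dE (x : ℝ) : HasDerivAt E (-(2 * α + 1) / (α + 1) ^ 2 * J1 x ^ 2) x := by
    have := ((dJ x).pow 2).add
      ((((hasDerivAt_id x).div_const ((α + 1) ^ 2))).mul ((dJ1 x).pow 2))
    refine this.congr_deriv ?_
    simp only [id, Nat.cast_ofNat, Pi.pow_apply]
    have h1' : (α + 1) * (α + 1)⁻¹ = 1 := mul_inv_cancel₀ h1.ne'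
    rw [hc x]
    simp only [div_eq_mul_inv, mul_inv, ← inv_pow]
    linear_combination (2 * (α + 1)⁻¹ * J1 x ^ 2) * h1'
  have hanti : Antitone E := by
    refine antitone_of_deriv_nonpos (fun x => (dE x).differentiableAt) fun x => ?_
    rw [(dE x).deriv, neg_div, neg_mul]
    have : 0 ≤ 2 * α + 1 := by linarith
    exact neg_nonpos.2 (by positivity)
  have h0 : E 0 = 1 := by simp [hE, hJ, besselE_zero hα]
  have := (hanti hw).trans_eq h0
  have h3 : J w ^ 2 ≤ 1 := by
    have : 0 ≤ w / (α + 1) ^ 2 * J1 w ^ 2 := by positivity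
    simp only [hE] at *
    linarith
  exact (sq_le_one_iff_abs_le_one _).1 h3

lemma besselJ_ofReal (x : ℝ) : (besselJ α x : ℂ) = besselE α (((x / 2) ^ 2 : ℝ) : ℂ) := by
  rw [besselJ, besselE, ← tsum_mul_left, Complex.ofReal_tsum]
  congr 1
  ext n
  rw [besselCoeff, pow_mul]
  push_cast
  ring

lemma abs_besselJ_le_one (hα : -1/2 < α) (x : ℝ) : |besselJ α x| ≤ 1 := by
  rw [← Complex.ofReal_re (besselJ α x), besselJ_ofReal]
  exact abs_besselE_re_le_one hα (sq_nonneg _)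

lemma continuous_besselJ (hα : -1/2 < α) : Continuous (besselJ α) := by
  have : besselJ α = fun x => (besselE α (((x / 2) ^ 2 : ℝ) : ℂ)).re := by
    ext x; rw [← besselJ_ofReal, Complex.ofReal_re]
  rw [this]
  exact Complex.continuous_re.comp ((continuous_besselE hα).comp (by fun_prop))

lemma measurable_muB_density :
    Measurable fun x : ℝ => ENNReal.ofReal (2 * π ^ (α+1) / Gamma (α+1) * x ^ (2*α+1)) := by
  fun_prop

instance : SFinite (muB α) := by unfold muB; infer_instance

lemma ae_nonneg_muB : ∀ᵐ x ∂(muB α), 0 ≤ x :=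
  (withDensity_absolutelyContinuous _ _).ae_le (ae_restrict_mem measurableSet_Ici)

lemma muB_const_pos (hα : -1/2 < α) : 0 < 2 * π ^ (α+1) / Gamma (α+1) := by
  have := gamma_add_one_pos hα
  positivity

lemma muB_add_one (hα : -1/2 < α) :
    muB (α + 1) = (muB α).withDensity fun x => ENNReal.ofReal (π / (α + 1) * x ^ 2) := by
  rw [muB, muB, ← withDensity_mul _ measurable_muB_density (by fun_prop)]
  refine withDensity_congr_ae ?_
  filter_upwards [ae_restrict_mem measurableSet_Ici] with x hx
  have hx : 0 ≤ x := hx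
  have h1 : α + 1 ≠ 0 := by linarith
  have := gamma_add_one_pos hα
  rw [Pi.mul_apply, ← ENNReal.ofReal_mul (mul_nonneg (muB_const_pos hα).le (rpow_nonneg hx _)),
    Gamma_add_one h1, rpow_add pi_pos (α + 1) 1, rpow_one,
    show 2 * (α + 1) + 1 = (2 * α + 1) + (2 : ℕ) by push_cast; ring,
    rpow_add' hx (by push_cast; linarith), rpow_natCast]
  congr 1
  field_simp

lemma integral_muB_add_one {E : Type*} [NormedAddCommGroup E] [NormedSpace ℝ E] (hα : -1/2 < α)
    (g : ℝ → E) : ∫ x, g x ∂(muB (α + 1)) = ∫ x, (π / (α + 1) * x ^ 2) • g x ∂(muB α) := by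
  have h1 : 0 < α + 1 := by linarith
  rw [muB_add_one hα, integral_withDensity_eq_integral_toReal_smul (by fun_prop) (by simp)]
  congr 1
  ext x
  rw [ENNReal.toReal_ofReal (by positivity)]

lemma integrable_muB_iff (hα : -1/2 < α) (g : ℝ → ℝ) :
    Integrable g (muB α) ↔
      IntegrableOn (fun x => 2 * π ^ (α+1) / Gamma (α+1) * x ^ (2*α+1) * g x) (Ioi 0) := by
  rw [muB, integrable_withDensity_iff_integrable_smul' measurable_muB_density (by simp),
    ← integrableOn_Ici_iff_integrableOn_Ioi, IntegrableOn]
  refine integrable_congr ?_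
  filter_upwards [ae_restrict_mem measurableSet_Ici] with x hx
  rw [ENNReal.toReal_ofReal (mul_nonneg (muB_const_pos hα).le (rpow_nonneg hx _)), smul_eq_mul]

lemma integral_muB (hα : -1/2 < α) (g : ℝ → ℝ) :
    ∫ x, g x ∂(muB α) =
      ∫ x in Ioi 0, 2 * π ^ (α+1) / Gamma (α+1) * x ^ (2*α+1) * g x := by
  rw [muB, integral_withDensity_eq_integral_toReal_smul measurable_muB_density (by simp),
    ← integral_Ici_eq_integral_Ioi]
  refine integral_congr_ae ?_
  filter_upwards [ae_restrict_mem measurableSet_Ici] with x hx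
  rw [ENNReal.toReal_ofReal (mul_nonneg (muB_const_pos hα).le (rpow_nonneg hx _)), smul_eq_mul]

lemma muB_gaussian_moment_eqOn (n : ℕ) (s : ℝ) :
    EqOn (fun x : ℝ => 2 * π ^ (α+1) / Gamma (α+1) * x ^ (2*α+1) *
      (x ^ (2 * n) * exp (-(π * s * x ^ 2))))
      (fun x => 2 * π ^ (α+1) / Gamma (α+1) *
        (x ^ (2 * α + 1 + 2 * n) * exp (-(π * s) * x ^ (2 : ℝ)))) (Ioi 0) := by
  intro x hx
  have hx : 0 < x := hx
  have h : x ^ (2 * n) = x ^ (2 * n : ℝ) := by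
    rw [← rpow_natCast]; push_cast; rfl
  have h2 : x ^ (2 : ℝ) = x ^ 2 := by exact_mod_cast rpow_natCast x 2
  simp only
  rw [rpow_add hx (2 * α + 1), h, h2, neg_mul]
  ring

lemma integrable_gaussian_moment (hα : -1/2 < α) (n : ℕ) {s : ℝ} (hs : 0 < s) :
    Integrable (fun x : ℝ => x ^ (2 * n) * exp (-(π * s * x ^ 2))) (muB α) := by
  rw [integrable_muB_iff hα, integrableOn_congr_fun (muB_gaussian_moment_eqOn n s)
    measurableSet_Ioi]
  have hn := n.cast_nonneg (α := ℝ)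
  exact (integrableOn_rpow_mul_exp_neg_mul_rpow (by linarith) (by norm_num)
    (by positivity)).const_mul _

lemma integral_gaussian_moment (hα : -1/2 < α) (n : ℕ) {s : ℝ} (hs : 0 < s) :
    ∫ x, x ^ (2 * n) * exp (-(π * s * x ^ 2)) ∂(muB α) =
      Gamma (n + α + 1) / Gamma (α + 1) * (π⁻¹ ^ n * s⁻¹ ^ n * s ^ (-(α + 1))) := by
  have hn := n.cast_nonneg (α := ℝ)
  have hg := gamma_add_one_pos hα
  rw [integral_muB hα, setIntegral_congr_fun measurableSet_Ioi (muB_gaussian_moment_eqOn n s),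
    integral_const_mul, integral_rpow_mul_exp_neg_mul_rpow (by norm_num) (by linarith)
    (by positivity), show (2 * α + 1 + 2 * n + 1) / 2 = n + α + 1 by ring,
    show -(2 * α + 1 + 2 * n + 1) / 2 = -(α + 1) + -n by ring, mul_rpow pi_pos.le hs.le,
    rpow_add pi_pos (-(α + 1)), rpow_add hs, rpow_neg pi_pos.le (α + 1), rpow_neg pi_pos.le n,
    rpow_neg hs.le n, rpow_natCast, rpow_natCast, inv_pow, inv_pow]
  have := (rpow_pos_of_pos pi_pos (α + 1)).ne'
  field_simp

lemma integrable_gaussian (hα : -1/2 < α) {s : ℝ} (hs : 0 < s) :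
    Integrable (fun x : ℝ => exp (-(π * s * x ^ 2))) (muB α) := by
  simpa using integrable_gaussian_moment hα 0 hs

lemma integral_gaussian_muB (hα : -1/2 < α) {s : ℝ} (hs : 0 < s) :
    ∫ x, exp (-(π * s * x ^ 2)) ∂(muB α) = s ^ (-(α + 1)) := by
  have := (gamma_add_one_pos hα).ne'
  simpa [this] using integral_gaussian_moment hα 0 hs

/-- The Fourier-Bessel transform of a Gaussian is a Gaussian. -/
lemma fourierBessel_gaussian (hα : -1/2 < α) {s : ℝ} (hs : 0 < s) (y : ℝ) :
    fourierBessel α (fun x => (exp (-(π * s * x ^ 2)) : ℂ)) y =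
      ((s ^ (-(α + 1)) * exp (-(π * s⁻¹ * y ^ 2)) : ℝ) : ℂ) := by
  set F : ℕ → ℝ → ℝ := fun n x =>
    besselCoeff α n * (π * y) ^ (2 * n) * (x ^ (2 * n) * exp (-(π * s * x ^ 2))) with hF
  set T : ℕ → ℝ := fun n => (π * s⁻¹ * y ^ 2) ^ n / n.factorial * s ^ (-(α + 1)) with hT
  have hg := (gamma_add_one_pos hα).ne'
  have hint (n : ℕ) : Integrable (F n) (muB α) := (integrable_gaussian_moment hα n hs).const_mul _
  have hmul (n : ℕ) : besselCoeff α n * (π * y) ^ (2 * n) * (Gamma (n + α + 1) / Gamma (α + 1) *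
      (π⁻¹ ^ n * s⁻¹ ^ n * s ^ (-(α + 1)))) = (-1) ^ n * T n := by
    have hg' := (gamma_nat_add_pos hα n).ne'
    simp only [besselCoeff, hT, pow_mul, mul_pow, inv_pow]
    field_simp
    ring
  have hval (n : ℕ) : ∫ x, F n x ∂(muB α) = (-1) ^ n * T n := by
    rw [hF, integral_const_mul, integral_gaussian_moment hα n hs, hmul]
  have hT0 (n : ℕ) : 0 ≤ T n := by have := rpow_nonneg hs.le (-(α + 1)); positivity
  have hnorm (n : ℕ) : ∫ x, ‖F n x‖ ∂(muB α) = T n := by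
    have h1 (x : ℝ) : ‖F n x‖ = (|besselCoeff α n| * (π * y) ^ (2 * n)) *
        (x ^ (2 * n) * exp (-(π * s * x ^ 2))) := by
      have h2 : 0 ≤ (π * y) ^ (2 * n) := by rw [pow_mul]; positivity
      have h3 : 0 ≤ x ^ (2 * n) := by rw [pow_mul]; positivity
      rw [norm_eq_abs, hF, abs_mul, abs_mul, abs_of_nonneg h2,
        abs_of_nonneg (mul_nonneg h3 (exp_pos _).le)]
    simp_rw [h1]
    rw [integral_const_mul, integral_gaussian_moment hα n hs]
    have h4 := congrArg abs (hmul n)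
    rw [abs_mul ((-1) ^ n), abs_pow, abs_neg, abs_one, one_pow, one_mul, abs_of_nonneg (hT0 n)]
      at h4
    rw [← h4, abs_mul, abs_mul, abs_of_nonneg (a := (π * y) ^ (2 * n))
      (by rw [pow_mul]; positivity), abs_of_nonneg (a := _ / _ * _)]
    have := gamma_nat_add_pos hα n
    have := gamma_add_one_pos hα
    positivity
  have hsumT : Summable T := (Real.summable_pow_div_factorial _).mul_right _
  have key := hasSum_integral_of_summable_integral_norm hint (by simpa only [hnorm] using hsumT)
  have hpt (x : ℝ) : (∑' n, F n x) = besselJ α (2 * π * x * y) * exp (-(π * s * x ^ 2)) := by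
    rw [besselJ, ← tsum_mul_left, ← tsum_mul_right]
    congr 1
    ext n
    simp only [hF, besselCoeff]
    rw [show 2 * π * x * y / 2 = (π * y) * x by ring, mul_pow (π * y)]
    ring
  have hsum2 : HasSum (fun n => (-1) ^ n * T n) (exp (-(π * s⁻¹ * y ^ 2)) * s ^ (-(α + 1))) := by
    have := (NormedSpace.expSeries_div_hasSum_exp (-(π * s⁻¹ * y ^ 2))).mul_right (s ^ (-(α + 1)))
    rw [← Real.exp_eq_exp_ℝ] at this
    convert! this using 2 with n
    rw [hT, neg_pow]
    ring
  simp_rw [hval, hpt] at key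
  have heq := hsum2.unique key
  rw [fourierBessel, mul_comm (s ^ _), heq, ← integral_complex_ofReal]
  congr 1
  ext x
  push_cast
  ring

/-- If all moments of a bounded `u` against the density `h` vanish, then so do the integrals of `h`
over the preimages under `u`. -/
lemma setIntegral_preimage_eq_zero_of_moments {X : Type*} [MeasurableSpace X] {μ : Measure X}
    {h : X → ℝ} (hh : Integrable h μ) {u : X → ℝ} (hu : Measurable u) (hb : ∀ x, |u x| ≤ 1)
    (hm : ∀ n : ℕ, ∫ x, h x * u x ^ n ∂μ = 0) {B : Set ℝ} (hB : MeasurableSet B) :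
    ∫ x in u ⁻¹' B, h x ∂μ = 0 := by
  have hfP : IsFiniteMeasure (μ.withDensity fun x => ENNReal.ofReal (h x)) :=
    isFiniteMeasure_withDensity_ofReal hh.2
  have hfN : IsFiniteMeasure (μ.withDensity fun x => ENNReal.ofReal (-h x)) :=
    isFiniteMeasure_withDensity_ofReal hh.neg.2
  have hmP : AEMeasurable (fun x => ENNReal.ofReal (h x)) μ := hh.1.aemeasurable.ennreal_ofReal
  have hmN : AEMeasurable (fun x => ENNReal.ofReal (-h x)) μ := hh.1.aemeasurable.neg.ennreal_ofReal
  have hexp (t : ℝ) : ∫ x, (h x : ℂ) * Complex.exp (t * u x * Complex.I) ∂μ = 0 := by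
    set F : ℕ → X → ℂ := fun n x =>
      ((t : ℂ) * Complex.I) ^ n / n.factorial * ((h x * u x ^ n : ℝ) : ℂ) with hF
    have hi (n : ℕ) : Integrable (fun x => h x * u x ^ n) μ :=
      hh.mul_bdd (c := 1) (hu.pow_const n).aestronglyMeasurable
        (ae_of_all _ fun x => by
          rw [norm_pow, norm_eq_abs]; exact pow_le_one₀ (abs_nonneg _) (hb x))
    have hFi (n : ℕ) : Integrable (F n) μ := (hi n).ofReal.const_mul _
    have hFn (n : ℕ) : ∫ x, ‖F n x‖ ∂μ ≤ |t| ^ n / n.factorial * ∫ x, ‖h x‖ ∂μ := by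
      rw [← integral_const_mul]
      refine integral_mono (hFi n).norm (hh.norm.const_mul _) fun x => ?_
      simp only [hF, norm_mul, norm_div, norm_pow, Complex.norm_I, mul_one, Complex.norm_real,
        norm_eq_abs, Complex.norm_natCast]
      gcongr
      exact mul_le_of_le_one_right (abs_nonneg _) (pow_le_one₀ (abs_nonneg _) (hb x))
    have hs : Summable fun n => ∫ x, ‖F n x‖ ∂μ :=
      .of_nonneg_of_le (fun n => integral_nonneg fun x => norm_nonneg _) hFn
        ((Real.summable_pow_div_factorial _).mul_right _)
    have key := hasSum_integral_of_summable_integral_norm hFi hs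
    have h0 (n : ℕ) : ∫ x, F n x ∂μ = 0 := by
      rw [hF, integral_const_mul, integral_complex_ofReal, hm]; simp
    simp only [h0] at key
    refine Eq.trans ?_ (hasSum_zero.unique key).symm
    congr 1
    ext x
    rw [Complex.exp_eq_exp_ℂ, NormedSpace.exp_eq_tsum_div, ← tsum_mul_left]
    congr 1
    ext n
    simp only [hF]
    push_cast
    ring
  have hmap : (μ.withDensity fun x => ENNReal.ofReal (h x)).map u =
      (μ.withDensity fun x => ENNReal.ofReal (-h x)).map u := by
    refine Measure.ext_of_charFun ?_
    ext t
    have hc (ν : Measure ℝ) : AEStronglyMeasurable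
        (fun x : ℝ => Complex.exp (t * x * Complex.I)) ν :=
      Continuous.aestronglyMeasurable (by fun_prop)
    rw [charFun_apply_real, charFun_apply_real, integral_map hu.aemeasurable (hc _),
      integral_map hu.aemeasurable (hc _),
      integral_withDensity_eq_integral_toReal_smul₀ hmP (by simp),
      integral_withDensity_eq_integral_toReal_smul₀ hmN (by simp), ← sub_eq_zero, ← hexp t]
    have hmeas : AEStronglyMeasurable (fun x => Complex.exp (t * u x * Complex.I)) μ :=
      (Measurable.aestronglyMeasurable (by fun_prop))
    have hbd : ∀ᵐ x ∂μ, ‖Complex.exp (t * u x * Complex.I)‖ ≤ 1 := ae_of_all _ fun x => by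
      rw [← Complex.ofReal_mul, Complex.norm_exp_ofReal_mul_I]
    simp only [Complex.real_smul, ENNReal.toReal_ofReal']
    rw [← integral_sub]
    · congr 1
      ext x
      rw [← sub_mul, ← Complex.ofReal_sub, max_zero_sub_max_neg_zero_eq_self]
    · exact hh.pos_part.ofReal.mul_bdd hmeas hbd
    · exact hh.neg_part.ofReal.mul_bdd hmeas hbd
  have hBu := hu hB
  have := congrArg (fun ν => ν B) hmap
  simp only [Measure.map_apply hu hB, withDensity_apply _ hBu] at this
  rw [integral_eq_lintegral_pos_part_sub_lintegral_neg_part hh.integrableOn, this, sub_self]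

/-- The Gaussian `x ↦ exp (-π s x²)`, as a complex-valued function. -/
noncomputable def gauss (s x : ℝ) : ℂ := (exp (-(π * s * x ^ 2)) : ℂ)

lemma continuous_gauss (s : ℝ) : Continuous (gauss s) := by
  unfold gauss; fun_prop

lemma norm_gauss (s x : ℝ) : ‖gauss s x‖ = exp (-(π * s * x ^ 2)) := by
  rw [gauss, Complex.norm_real, norm_eq_abs, abs_of_pos (exp_pos _)]

lemma norm_gauss_le_one {s : ℝ} (hs : 0 < s) (x : ℝ) : ‖gauss s x‖ ≤ 1 := by
  rw [norm_gauss, exp_le_one_iff, neg_nonpos]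
  positivity

lemma integrable_gauss (hα : -1/2 < α) {s : ℝ} (hs : 0 < s) : Integrable (gauss s) (muB α) :=
  (integrable_gaussian hα hs).ofReal

lemma gauss_mul_gauss (s t x : ℝ) : gauss s x * gauss t x = gauss (s + t) x := by
  simp only [gauss]
  rw [← Complex.ofReal_mul, ← exp_add]
  ring_nf

lemma real_ae_eq_zero_of_moments {h : ℝ → ℝ} (hh : Integrable h (muB α))
    (hm : ∀ n : ℕ, ∫ x, h x * exp (-(π * x ^ 2)) ^ n ∂(muB α) = 0) : h =ᵐ[muB α] 0 := by
  refine hh.ae_eq_zero_of_forall_setIntegral_eq_zero fun A hA _ => ?_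
  have hinv : Measurable fun v : ℝ => √(-log v / π) := by fun_prop
  have key := setIntegral_preimage_eq_zero_of_moments hh
    (u := fun x => exp (-(π * x ^ 2))) (by fun_prop) (fun x => by
      rw [abs_of_pos (exp_pos _), exp_le_one_iff, neg_nonpos]; positivity) hm (hinv hA)
  rw [← key]
  refine setIntegral_congr_set ?_
  filter_upwards [ae_nonneg_muB] with x hx
  refine propext ?_
  change x ∈ A ↔ √(-log (exp (-(π * x ^ 2))) / π) ∈ A
  rw [log_exp, neg_neg, mul_div_cancel_left₀ _ pi_ne_zero, sqrt_sq hx]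

/-- A function orthogonal to all Gaussians vanishes. -/
lemma ae_eq_zero_of_integral_gauss {h : ℝ → ℂ}
    (hi : Integrable (fun x => gauss 1 x * h x) (muB α))
    (hz : ∀ s : ℝ, 0 < s → ∫ x, gauss s x * h x ∂(muB α) = 0) : h =ᵐ[muB α] 0 := by
  have hpow (n : ℕ) (x : ℝ) :
      gauss 1 x * h x * ((exp (-(π * x ^ 2)) ^ n : ℝ) : ℂ) = gauss (1 + n) x * h x := by
    have : ((exp (-(π * x ^ 2)) ^ n : ℝ) : ℂ) = gauss n x := by
      rw [gauss, ← exp_nat_mul]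
      ring_nf
    rw [this, ← gauss_mul_gauss]
    ring
  have hi' (n : ℕ) :
      Integrable (fun x => gauss 1 x * h x * ((exp (-(π * x ^ 2)) ^ n : ℝ) : ℂ)) (muB α) :=
    hi.mul_bdd (c := 1) (Continuous.aestronglyMeasurable (by fun_prop)) <| ae_of_all _ fun x => by
      rw [Complex.norm_real, norm_pow, norm_eq_abs, abs_of_pos (exp_pos _)]
      refine pow_le_one₀ (exp_pos _).le ?_
      rw [exp_le_one_iff, neg_nonpos]
      positivity
  have hz' (n : ℕ) :
      ∫ x, gauss 1 x * h x * ((exp (-(π * x ^ 2)) ^ n : ℝ) : ℂ) ∂(muB α) = 0 := by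
    simp_rw [hpow]
    exact hz _ (by positivity)
  have hre := real_ae_eq_zero_of_moments (α := α) hi.re fun n => by
    have := congrArg Complex.re (hz' n)
    rw [← Complex.reCLM_apply, ← ContinuousLinearMap.integral_comp_comm _ (hi' n)] at this
    simp only [Complex.reCLM_apply, Complex.re_mul_ofReal] at this
    exact this
  have him := real_ae_eq_zero_of_moments (α := α) hi.im fun n => by
    have := congrArg Complex.im (hz' n)
    rw [← Complex.imCLM_apply, ← ContinuousLinearMap.integral_comp_comm _ (hi' n)] at this
    simp only [Complex.imCLM_apply, Complex.im_mul_ofReal] at this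
    exact this
  filter_upwards [hre, him] with x h1 h2
  have h3 : gauss 1 x * h x = 0 := Complex.ext h1 h2
  refine (mul_eq_zero.1 h3).resolve_left ?_
  rw [gauss]
  exact_mod_cast (exp_pos _).ne'

lemma continuous_besselJ_mul (hα : -1/2 < α) :
    Continuous fun p : ℝ × ℝ => (besselJ α (2 * π * p.1 * p.2) : ℂ) :=
  Complex.continuous_ofReal.comp ((continuous_besselJ hα).comp (by fun_prop))

lemma norm_besselJ_le_one (hα : -1/2 < α) (x : ℝ) : ‖(besselJ α x : ℂ)‖ ≤ 1 := by
  rw [Complex.norm_real, norm_eq_abs]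
  exact abs_besselJ_le_one hα x

lemma norm_mul_besselJ_le (hα : -1/2 < α) (f : ℝ → ℂ) (x y : ℝ) :
    ‖f x * (besselJ α (2 * π * x * y) : ℂ)‖ ≤ ‖f x‖ := by
  rw [norm_mul]
  exact mul_le_of_le_one_right (norm_nonneg _) (norm_besselJ_le_one hα _)

lemma norm_fourierBessel_le (hα : -1/2 < α) {f : ℝ → ℂ} (hf : Integrable f (muB α)) (y : ℝ) :
    ‖fourierBessel α f y‖ ≤ ∫ x, ‖f x‖ ∂(muB α) :=
  norm_integral_le_of_norm_le hf.norm (ae_of_all _ fun x => norm_mul_besselJ_le hα f x y)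

lemma continuous_fourierBessel (hα : -1/2 < α) {f : ℝ → ℂ} (hf : Integrable f (muB α)) :
    Continuous (fourierBessel α f) := by
  refine continuous_of_dominated (fun y => hf.1.mul ?_)
    (fun y => ae_of_all _ fun x => norm_mul_besselJ_le hα f x y) hf.norm
    (ae_of_all _ fun x => ?_)
  · exact ((continuous_besselJ_mul hα).comp (Continuous.prodMk_left y)).aestronglyMeasurable
  · exact continuous_const.mul ((continuous_besselJ_mul hα).comp (Continuous.prodMk_right x))

/-- The multiplication formula. -/
lemma integral_fourierBessel_mul (hα : -1/2 < α) {f g : ℝ → ℂ} (hf : Integrable f (muB α))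
    (hg : Integrable g (muB α)) :
    ∫ y, fourierBessel α f y * g y ∂(muB α) = ∫ x, f x * fourierBessel α g x ∂(muB α) := by
  have hint : Integrable (fun p : ℝ × ℝ => f p.2 * (besselJ α (2 * π * p.2 * p.1) : ℂ) * g p.1)
      ((muB α).prod (muB α)) := by
    have hc : Continuous fun p : ℝ × ℝ => (besselJ α (2 * π * p.2 * p.1) : ℂ) :=
      Complex.continuous_ofReal.comp ((continuous_besselJ hα).comp (by fun_prop))
    have h := (hg.mul_prod hf).mul_bdd (c := 1) hc.aestronglyMeasurable
      (ae_of_all _ fun p => norm_besselJ_le_one hα _)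
    refine h.congr (ae_of_all _ fun p => ?_)
    simp only
    ring
  have := integral_integral_swap (f := fun y x => f x * (besselJ α (2 * π * x * y) : ℂ) * g y) hint
  simp only [fourierBessel]
  simp_rw [← integral_mul_const, ← integral_const_mul]
  rw [this]
  congr 1
  ext x
  congr 1
  ext y
  rw [mul_right_comm (2 * π)]
  ring

lemma fourierBessel_gauss (hα : -1/2 < α) {s : ℝ} (hs : 0 < s) (y : ℝ) :
    fourierBessel α (gauss s) y = ((s ^ (-(α + 1)) : ℝ) : ℂ) * gauss s⁻¹ y := by
  rw [gauss, ← Complex.ofReal_mul]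
  exact fourierBessel_gaussian hα hs y

lemma fourierBessel_fourierBessel_gauss (hα : -1/2 < α) {s : ℝ} (hs : 0 < s) (y : ℝ) :
    fourierBessel α (fun x => ((s ^ (-(α + 1)) : ℝ) : ℂ) * gauss s⁻¹ x) y = gauss s y := by
  simp only [fourierBessel, mul_assoc (((s ^ (-(α + 1)) : ℝ) : ℂ))]
  rw [integral_const_mul]
  have := fourierBessel_gauss hα (inv_pos.2 hs) y
  rw [fourierBessel] at this
  rw [this, inv_inv, ← mul_assoc, ← Complex.ofReal_mul, ← mul_rpow hs.le (inv_pos.2 hs).le,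
    mul_inv_cancel₀ hs.ne', one_rpow, Complex.ofReal_one, one_mul]

/-- Fourier-Bessel inversion. -/
theorem fourierBessel_inversion (hα : -1/2 < α) {f : ℝ → ℂ} (hf : Integrable f (muB α))
    (hF : Integrable (fourierBessel α f) (muB α)) :
    f =ᵐ[muB α] fourierBessel α (fourierBessel α f) := by
  set F := fourierBessel α f
  have hi {s : ℝ} (hs : 0 < s) : Integrable (fun x => gauss s x * f x) (muB α) :=
    hf.bdd_mul (c := 1) (continuous_gauss s).aestronglyMeasurable
      (ae_of_all _ (norm_gauss_le_one hs))
  have hi' {s : ℝ} (hs : 0 < s) :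
      Integrable (fun x => gauss s x * fourierBessel α F x) (muB α) :=
    (integrable_gauss hα hs).mul_bdd (continuous_fourierBessel hα hF).aestronglyMeasurable
      (ae_of_all _ (norm_fourierBessel_le hα hF))
  have key := ae_eq_zero_of_integral_gauss (α := α) (h := fun x => f x - fourierBessel α F x) ?_ ?_
  · filter_upwards [key] with x hx
    exact sub_eq_zero.1 hx
  · simp_rw [mul_sub]
    exact (hi one_pos).sub (hi' one_pos)
  · intro s hs
    simp_rw [mul_sub]
    have hg : Integrable (fun x => ((s ^ (-(α + 1)) : ℝ) : ℂ) * gauss s⁻¹ x) (muB α) :=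
      (integrable_gauss hα (inv_pos.2 hs)).const_mul _
    have e1 := integral_fourierBessel_mul hα hf hg
    simp_rw [fourierBessel_fourierBessel_gauss hα hs] at e1
    have e2 := integral_fourierBessel_mul hα hF (integrable_gauss hα hs)
    simp_rw [fourierBessel_gauss hα hs] at e2
    rw [integral_sub (hi hs) (hi' hs), sub_eq_zero]
    simp_rw [mul_comm (gauss s _)]
    exact e1.symm.trans e2.symm

/-- If two families in Hilbert space have the same Gram matrix and the first one is total, then
a vector is no longer than any vector having the same inner products with the second family. -/
lemma norm_le_of_gram_eq {ι E : Type*} [NormedAddCommGroup E] [InnerProductSpace ℂ E]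
    [CompleteSpace E] {γ γ' : ι → E}
    (hγ : ∀ i j, inner ℂ (γ i) (γ j) = inner ℂ (γ' i) (γ' j))
    (htot : ∀ v : E, (∀ i, inner ℂ (γ i) v = 0) → v = 0) {u v : E}
    (huv : ∀ i, inner ℂ (γ i) u = inner ℂ (γ' i) v) : ‖u‖ ≤ ‖v‖ := by
  have hspan : ∀ x ∈ Submodule.span ℂ (range γ), ‖inner ℂ x u‖ ≤ ‖x‖ * ‖v‖ := by
    intro x hx
    obtain ⟨c, rfl⟩ := Finsupp.mem_span_range_iff_exists_finsupp.1 hx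
    have h1 : inner ℂ (c.sum fun i a => a • γ i) u = inner ℂ (c.sum fun i a => a • γ' i) v := by
      simp only [Finsupp.sum, sum_inner, inner_smul_left, huv]
    have h2 : ‖c.sum fun i a => a • γ i‖ = ‖c.sum fun i a => a • γ' i‖ := by
      rw [@norm_eq_sqrt_re_inner ℂ, @norm_eq_sqrt_re_inner ℂ]
      simp only [Finsupp.sum, sum_inner, inner_sum, inner_smul_left, inner_smul_right, hγ]
    rw [h1, h2]
    exact norm_inner_le_norm _ _
  have hdense : (Submodule.span ℂ (range γ)).topologicalClosure = ⊤ := by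
    rw [Submodule.topologicalClosure_eq_top_iff, eq_bot_iff]
    intro w hw
    exact htot w fun i => (Submodule.mem_orthogonal _ _).1 hw _
      (Submodule.subset_span (mem_range_self i))
  have hu : u ∈ closure (Submodule.span ℂ (range γ) : Set E) := by
    rw [← Submodule.topologicalClosure_coe, hdense]
    trivial
  have hcl : IsClosed {x : E | ‖inner ℂ x u‖ ≤ ‖x‖ * ‖v‖} :=
    isClosed_le (by fun_prop) (by fun_prop)
  have h := closure_minimal hspan hcl hu
  have h' : ‖u‖ * ‖u‖ ≤ ‖u‖ * ‖v‖ := by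
    rw [← inner_self_eq_norm_mul_norm (𝕜 := ℂ)]
    exact (Complex.re_le_norm _).trans h
  by_contra! hlt
  exact absurd h' (not_le.2 (mul_lt_mul_of_pos_left hlt ((norm_nonneg v).trans_lt hlt)))

lemma memLp_gauss (hα : -1/2 < α) {s : ℝ} (hs : 0 < s) : MemLp (gauss s) 2 (muB α) := by
  rw [memLp_two_iff_integrable_sq_norm (continuous_gauss s).aestronglyMeasurable]
  refine (integrable_gaussian hα (add_pos hs hs)).congr (ae_of_all _ fun x => ?_)
  simp only
  rw [norm_gauss, sq (exp _), ← exp_add]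
  ring_nf

lemma inner_toLp {X : Type*} [MeasurableSpace X] {μ : Measure X} {f g : X → ℂ}
    (hf : MemLp f 2 μ) (hg : MemLp g 2 μ) :
    inner ℂ (hf.toLp f) (hg.toLp g) = ∫ x, g x * (starRingEnd ℂ) (f x) ∂μ := by
  rw [L2.inner_def]
  refine integral_congr_ae ?_
  filter_upwards [hf.coeFn_toLp, hg.coeFn_toLp] with x h1 h2
  rw [h1, h2, RCLike.inner_apply]

lemma norm_sq_toLp {X : Type*} [MeasurableSpace X] {μ : Measure X} {f : X → ℂ}
    (hf : MemLp f 2 μ) : ‖hf.toLp f‖ ^ 2 = ∫ x, ‖f x‖ ^ 2 ∂μ := by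
  have h := inner_self_eq_norm_sq_to_K (𝕜 := ℂ) (hf.toLp f)
  rw [inner_toLp] at h
  simp_rw [Complex.mul_conj, Complex.normSq_eq_norm_sq] at h
  rw [integral_complex_ofReal] at h
  refine Complex.ofReal_injective (Eq.trans ?_ h.symm)
  push_cast
  rfl

lemma conj_gauss (s x : ℝ) : (starRingEnd ℂ) (gauss s x) = gauss s x := Complex.conj_ofReal _

lemma integral_gauss (hα : -1/2 < α) {s : ℝ} (hs : 0 < s) :
    ∫ x, gauss s x ∂(muB α) = ((s ^ (-(α + 1)) : ℝ) : ℂ) := by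
  rw [← integral_gaussian_muB hα hs, ← integral_complex_ofReal]
  rfl

/-- The Fourier-Bessel transform is a contraction for the `L²` norm. -/
theorem integral_norm_sq_fourierBessel_le (hα : -1/2 < α) {f : ℝ → ℂ}
    (hf : Integrable f (muB α)) (hf2 : MemLp f 2 (muB α))
    (hF2 : MemLp (fourierBessel α f) 2 (muB α)) :
    ∫ x, ‖fourierBessel α f x‖ ^ 2 ∂(muB α) ≤ ∫ x, ‖f x‖ ^ 2 ∂(muB α) := by
  rw [← norm_sq_toLp hF2, ← norm_sq_toLp hf2]
  have hg (s : {s : ℝ // 0 < s}) : MemLp (gauss s) 2 (muB α) := memLp_gauss hα s.2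
  have hg' (s : {s : ℝ // 0 < s}) :
      MemLp (fun x => (((s : ℝ) ^ (-(α + 1)) : ℝ) : ℂ) * gauss (s : ℝ)⁻¹ x) 2 (muB α) :=
    (memLp_gauss hα (inv_pos.2 s.2)).const_mul _
  gcongr
  refine norm_le_of_gram_eq (γ := fun s => (hg s).toLp _) (γ' := fun s => (hg' s).toLp _) ?_ ?_ ?_
  · rintro ⟨s, hs⟩ ⟨t, ht⟩
    have hs' := inv_pos.2 hs
    have ht' := inv_pos.2 ht
    simp only
    rw [inner_toLp, inner_toLp]
    simp only [map_mul, conj_gauss, Complex.conj_ofReal, gauss_mul_gauss]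
    have (x : ℝ) : ((t ^ (-(α + 1)) : ℝ) : ℂ) * gauss t⁻¹ x *
        (((s ^ (-(α + 1)) : ℝ) : ℂ) * gauss s⁻¹ x) =
        ((t ^ (-(α + 1)) * s ^ (-(α + 1)) : ℝ) : ℂ) * gauss (t⁻¹ + s⁻¹) x := by
      rw [← gauss_mul_gauss, Complex.ofReal_mul]; ring
    simp_rw [this]
    rw [integral_const_mul, integral_gauss hα (add_pos ht hs), integral_gauss hα (add_pos ht' hs'),
      ← Complex.ofReal_mul, ← mul_rpow ht.le hs.le, ← mul_rpow (by positivity) (by positivity)]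
    congr 2
    field_simp
    ring
  · intro v hv
    rw [Lp.eq_zero_iff_ae_eq_zero]
    have hi {s : ℝ} (hs : 0 < s) : ∫ x, gauss s x * v x ∂(muB α) = 0 := by
      have := hv ⟨s, hs⟩
      rw [← Lp.toLp_coeFn v (Lp.memLp v), inner_toLp] at this
      simpa only [conj_gauss, mul_comm] using this
    refine ae_eq_zero_of_integral_gauss ?_ fun s hs => hi hs
    exact (memLp_gauss hα one_pos).integrable_mul (Lp.memLp v)
  · rintro ⟨s, hs⟩
    simp only
    rw [inner_toLp, inner_toLp]
    simp only [map_mul, conj_gauss, Complex.conj_ofReal]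
    simp only [← fourierBessel_gauss hα hs]
    exact integral_fourierBessel_mul hα hf (integrable_gauss hα hs)

lemma integrable_muB_of_continuous {E : Type*} [NormedAddCommGroup E] (hα : -1/2 < α) {b : ℝ}
    (hb : 0 ≤ b) {g : ℝ → E} (hg : Continuous g) (hsupp : ∀ y, b < y → g y = 0) :
    Integrable g (muB α) := by
  obtain ⟨M, hM⟩ := (isCompact_Icc (a := 0) (b := b)).exists_bound_of_continuousOn hg.continuousOn
  refine Integrable.mono' ((integrable_gaussian hα one_pos).const_mul (M * exp (π * b ^ 2)))
    hg.aestronglyMeasurable ?_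
  filter_upwards [ae_nonneg_muB] with y hy
  rcases le_or_gt y b with hyb | hyb
  · have h0 := hM y ⟨hy, hyb⟩
    have hM0 : 0 ≤ M := (norm_nonneg _).trans h0
    rw [mul_assoc, ← exp_add]
    refine h0.trans (le_mul_of_one_le_right hM0 (one_le_exp ?_))
    have : π * y ^ 2 ≤ π * b ^ 2 := by gcongr
    linarith
  · rw [hsupp y hyb, norm_zero]
    have hM0 : 0 ≤ M := (norm_nonneg _).trans (hM 0 ⟨le_rfl, hb⟩)
    positivity

/-- The entire function `w ↦ ∫ G(y) j_α(2πy√w) dμ_α(y)`. -/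
noncomputable def besselIntegral (α : ℝ) (G : ℝ → ℂ) (w : ℂ) : ℂ :=
  ∫ y, G y * besselE α (((π * y) ^ 2 : ℝ) * w) ∂(muB α)

lemma besselIntegral_sq (G : ℝ → ℂ) (x : ℝ) :
    besselIntegral α G ((x : ℂ) ^ 2) = fourierBessel α G x := by
  simp only [besselIntegral, fourierBessel, besselJ_ofReal]
  congr 1
  ext y
  rw [← Complex.ofReal_pow, ← Complex.ofReal_mul]
  congr 3
  ring

lemma hasDerivAt_besselIntegral (hα : -1/2 < α) {b : ℝ} (hb : 0 ≤ b) {G : ℝ → ℂ}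
    (hG : Continuous G) (hsupp : ∀ y, b < y → G y = 0) (w : ℂ) :
    HasDerivAt (besselIntegral α G) (-π * besselIntegral (α + 1) G w) w := by
  have hα1 : -1/2 < α + 1 := by linarith
  have h1 : 0 < α + 1 := by linarith
  have hcE := continuous_besselE hα
  have hcE1 := continuous_besselE hα1
  have hF (z : ℂ) : Continuous fun y : ℝ => G y * besselE α (((π * y) ^ 2 : ℝ) * z) := by
    fun_prop
  have hF' (z : ℂ) : Continuous fun y : ℝ => G y * (-(1 / (α + 1)) *
      besselE (α + 1) (((π * y) ^ 2 : ℝ) * z) * ((π * y) ^ 2 : ℝ)) := by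
    fun_prop
  have key := (hasDerivAt_integral_of_dominated_loc_of_deriv_le (𝕜 := ℂ) (μ := muB α)
    (F := fun z y => G y * besselE α (((π * y) ^ 2 : ℝ) * z))
    (F' := fun z y => G y * (-(1 / (α + 1)) *
      besselE (α + 1) (((π * y) ^ 2 : ℝ) * z) * ((π * y) ^ 2 : ℝ)))
    (bound := fun y => ‖G y‖ * (1 / (α + 1) * exp (2 * ((π * y) ^ 2 * (‖w‖ + 1))) * (π * y) ^ 2))
    (Metric.ball_mem_nhds w one_pos)
    (.of_forall fun z => (hF z).aestronglyMeasurable)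
    (integrable_muB_of_continuous hα hb (hF w) fun y hy => by simp [hsupp y hy])
    (hF' w).aestronglyMeasurable
    (ae_of_all _ fun y z hz => ?_)
    (integrable_muB_of_continuous hα hb (by fun_prop) fun y hy => by simp [hsupp y hy])
    (ae_of_all _ fun y z _ => ?_)).2
  · refine HasDerivAt.congr_deriv (f := besselIntegral α G) key ?_
    rw [besselIntegral, integral_muB_add_one hα, ← integral_const_mul]
    congr 1
    ext y
    rw [Complex.real_smul]
    push_cast
    ring
  · have hz' : ‖z‖ ≤ ‖w‖ + 1 := by
      have := norm_le_norm_add_norm_sub' z w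
      have h2 := (mem_ball_iff_norm.1 hz).le
      linarith
    have h3 : ‖(-(1 / ((α : ℂ) + 1)))‖ = 1 / (α + 1) := by
      rw [norm_neg, show (1 / ((α : ℂ) + 1)) = ((1 / (α + 1) : ℝ) : ℂ) by push_cast; rfl,
        Complex.norm_real, norm_eq_abs, abs_of_pos (by positivity)]
    have h4 : ‖(((π * y) ^ 2 : ℝ) : ℂ)‖ = (π * y) ^ 2 := by
      rw [Complex.norm_real, norm_eq_abs, abs_of_nonneg (sq_nonneg _)]
    rw [norm_mul, norm_mul, norm_mul, h3, h4]
    gcongr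
    refine (norm_besselE_le hα1 _).trans ?_
    rw [norm_mul, h4]
    gcongr
  · have h5 : HasDerivAt (fun z : ℂ => (((π * y) ^ 2 : ℝ) : ℂ) * z) (((π * y) ^ 2 : ℝ) : ℂ) z := by
      simpa only [id, mul_one] using (hasDerivAt_id z).const_mul (((π * y) ^ 2 : ℝ) : ℂ)
    exact ((hasDerivAt_besselE hα _).comp z h5).const_mul (G y)

lemma iteratedDeriv_besselIntegral (hα : -1/2 < α) {b : ℝ} (hb : 0 ≤ b) {G : ℝ → ℂ}
    (hG : Continuous G) (hsupp : ∀ y, b < y → G y = 0) (k : ℕ) :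
    iteratedDeriv k (besselIntegral α G) = fun w => (-π : ℂ) ^ k * besselIntegral (α + k) G w := by
  induction k with
  | zero => simp
  | succ k ih =>
    have hαk : -1/2 < α + k := by have := k.cast_nonneg (α := ℝ); linarith
    rw [iteratedDeriv_succ, ih]
    ext w
    rw [((hasDerivAt_besselIntegral hαk hb hG hsupp w).const_mul _).deriv, Nat.cast_succ,
      ← add_assoc, pow_succ]
    ring

lemma integral_muB_add_nat_le (hα : -1/2 < α) {b : ℝ} (hb : 0 ≤ b) {g : ℝ → ℝ}
    (hg : Continuous g) (hg0 : ∀ y, 0 ≤ g y) (hsupp : ∀ y, b < y → g y = 0) (k : ℕ) :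
    ∫ y, g y ∂(muB (α + k)) ≤
      Gamma (α + 1) / Gamma (α + k + 1) * (π * b ^ 2) ^ k * ∫ y, g y ∂(muB α) := by
  have hΓ := gamma_add_one_pos hα
  induction k with
  | zero => simp [hΓ.ne']
  | succ k ih =>
    have hαk : -1/2 < α + k := by have := k.cast_nonneg (α := ℝ); linarith
    have hk : 0 < α + k + 1 := by linarith
    have hΓk := gamma_add_one_pos hαk
    rw [Nat.cast_succ, ← add_assoc, integral_muB_add_one hαk]
    calc ∫ y, (π / (α + k + 1) * y ^ 2) • g y ∂(muB (α + k))
        ≤ ∫ y, π / (α + k + 1) * b ^ 2 * g y ∂(muB (α + k)) := by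
          refine integral_mono_ae
            (integrable_muB_of_continuous hαk hb (by fun_prop) fun y hy => by simp [hsupp y hy])
            ((integrable_muB_of_continuous hαk hb hg hsupp).const_mul _) ?_
          filter_upwards [ae_nonneg_muB] with y hy
          rw [smul_eq_mul]
          rcases le_or_gt y b with hyb | hyb
          · have := hg0 y
            gcongr
          · simp [hsupp y hyb]
      _ ≤ π / (α + k + 1) * b ^ 2 *
          (Gamma (α + 1) / Gamma (α + k + 1) * (π * b ^ 2) ^ k * ∫ y, g y ∂(muB α)) := by
          rw [integral_const_mul]
          gcongr
      _ = _ := by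
          rw [Gamma_add_one hk.ne']
          field_simp
          ring

/-- The contraction estimate for a continuous function of bounded support; when the left hand side
is not integrable, its integral is zero by convention. -/
lemma integral_norm_sq_fourierBessel_le_of_continuous (hα : -1/2 < α) {b : ℝ} (hb : 0 ≤ b)
    {G : ℝ → ℂ} (hG : Continuous G) (hsupp : ∀ y, b < y → G y = 0) :
    ∫ x, ‖fourierBessel α G x‖ ^ 2 ∂(muB α) ≤ ∫ y, ‖G y‖ ^ 2 ∂(muB α) := by
  have hGi : Integrable G (muB α) := integrable_muB_of_continuous hα hb hG hsupp
  by_cases hi : Integrable (fun x => ‖fourierBessel α G x‖ ^ 2) (muB α)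
  · refine integral_norm_sq_fourierBessel_le hα hGi ?_ ?_
    · exact (memLp_two_iff_integrable_sq_norm hG.aestronglyMeasurable).2
        (integrable_muB_of_continuous hα hb (by fun_prop) fun y hy => by simp [hsupp y hy])
    · exact (memLp_two_iff_integrable_sq_norm
        (continuous_fourierBessel hα hGi).aestronglyMeasurable).2 hi
  · rw [integral_undef hi]
    positivity

end FourierBessel

open FourierBessel in
/-- Bernstein's inequality for the Fourier-Bessel transform.  If `f ∈ L¹_α` has
`ℱ_α f` supported in `[0,b]`, then `f` agrees (a.e.) on `ℝ⁺` with an even entire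
function `z ↦ H(z²)` (with `H` entire), and, since `D^k f (x) = H^{(k)}(x²)`,
the `L²_{α+k}` norms of the iterates of `D` are controlled. -/
theorem bernstein_inequality_fourier_bessel
    {α b : ℝ} (hα : -1/2 < α) (hb : 0 < b) {f : ℝ → ℂ}
    (hf1 : Integrable f (muB α))
    (hsupp : ∀ y : ℝ, b < y → fourierBessel α f y = 0) :
    ∃ H : ℂ → ℂ, Differentiable ℂ H ∧ (∀ᵐ x ∂(muB α), f x = H ((x:ℂ)^2)) ∧
      ∀ k : ℕ,
        Real.sqrt (∫ x, ‖iteratedDeriv k H ((x:ℂ)^2)‖^2 ∂(muB (α+k))) ≤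
          Real.sqrt (Gamma (α+1) / Gamma (α+k+1)) * (π ^ ((3:ℝ)/2) * b)^k *
            Real.sqrt (∫ x, ‖f x‖^2 ∂(muB α)) := by
  have hb0 := hb.le
  set F := fourierBessel α f
  have hFc : Continuous F := continuous_fourierBessel hα hf1
  have hFi : Integrable F (muB α) := integrable_muB_of_continuous hα hb0 hFc hsupp
  have hinv := fourierBessel_inversion hα hf1 hFi
  refine ⟨besselIntegral α F,
    fun w => (hasDerivAt_besselIntegral hα hb0 hFc hsupp w).differentiableAt, ?_, fun k => ?_⟩
  · filter_upwards [hinv] with x hx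
    rw [besselIntegral_sq, hx]
  have hf2 : MemLp f 2 (muB α) := by
    rw [memLp_two_iff_integrable_sq_norm hf1.1]
    refine (hf1.norm.const_mul (∫ y, ‖F y‖ ∂(muB α))).mono' (hf1.1.norm.pow 2) ?_
    filter_upwards [hinv] with x hx
    rw [norm_pow, norm_norm, sq]
    gcongr
    rw [hx]
    exact norm_fourierBessel_le hα hFi x
  have hF2c : Continuous fun y => ‖F y‖ ^ 2 := by fun_prop
  have hF2s (y : ℝ) (hy : b < y) : ‖F y‖ ^ 2 = 0 := by simp [hsupp y hy]
  have hF2 : MemLp F 2 (muB α) := (memLp_two_iff_integrable_sq_norm hFc.aestronglyMeasurable).2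
    (integrable_muB_of_continuous hα hb0 hF2c hF2s)
  have hαk : -1/2 < α + k := by have := k.cast_nonneg (α := ℝ); linarith
  have hΓ := gamma_add_one_pos hα
  have hΓk := gamma_add_one_pos hαk
  have hder (x : ℝ) : ‖iteratedDeriv k (besselIntegral α F) ((x : ℂ) ^ 2)‖ ^ 2 =
      (π ^ 2) ^ k * ‖fourierBessel (α + k) F x‖ ^ 2 := by
    rw [iteratedDeriv_besselIntegral hα hb0 hFc hsupp]
    beta_reduce
    rw [besselIntegral_sq, norm_mul, norm_pow,
      norm_neg, Complex.norm_real, norm_eq_abs, abs_of_pos pi_pos, mul_pow, ← pow_mul, ← pow_mul,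
      mul_comm k]
  have hpi : ((π ^ ((3 : ℝ) / 2)) ^ k) ^ 2 = (π ^ 3) ^ k := by
    rw [← pow_mul, mul_comm k, pow_mul, ← rpow_natCast (π ^ ((3 : ℝ) / 2)) 2, ← rpow_mul pi_pos.le,
      ← rpow_natCast π 3]
    norm_num
  simp_rw [hder]
  rw [integral_const_mul]
  refine Real.sqrt_le_iff.2 ⟨by positivity, ?_⟩
  have hf0 : 0 ≤ ∫ x, ‖f x‖ ^ 2 ∂(muB α) := integral_nonneg fun x => by positivity
  calc (π ^ 2) ^ k * ∫ x, ‖fourierBessel (α + k) F x‖ ^ 2 ∂(muB (α + k))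
      ≤ (π ^ 2) ^ k * (Gamma (α + 1) / Gamma (α + k + 1) * (π * b ^ 2) ^ k *
          ∫ x, ‖f x‖ ^ 2 ∂(muB α)) := by
        gcongr
        refine (integral_norm_sq_fourierBessel_le_of_continuous hαk hb0 hFc hsupp).trans
          ((integral_muB_add_nat_le hα hb0 hF2c (fun y => by positivity) hF2s k).trans ?_)
        exact mul_le_mul_of_nonneg_left (integral_norm_sq_fourierBessel_le hα hf1 hf2 hF2)
          (by positivity)
    _ = _ := by
        have hΓq : 0 ≤ Gamma (α + 1) / Gamma (α + k + 1) := by positivity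
        simp only [mul_pow, sq_sqrt hΓq, sq_sqrt hf0, hpi]
        ring
end

section
/- Let I ⊂ ℝ be a bounded interval of positive length and let J ⊆ I be a measurable set of positive Lebesgue measure. Let Φ be analytic on a neighborhood of D_I = {z ∈ ℂ : dist(z, I) ≤ 4|I|}, set M = max_{z ∈ D_I} |Φ(z)| and m = max_{x ∈ I} |Φ(x)|, and assume m > 0. Then ∫_I |Φ(s)|² ds ≤ (300 |I| / |J|)^{2 ln(M/m)/ln 2 + 1} ∫_J |Φ(s)|² ds. -/
open MeasureTheory Real Set

/-- A bounded set of measure larger than `n * δ` contains `n + 1` points that are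
`δ`-separated in increasing order. -/
lemma exists_separated_points {u v δ : ℝ} (hδ : 0 ≤ δ) (n : ℕ) :
    ∀ E : Set ℝ, E ⊆ Icc u v → n * δ < volume.real E →
      ∃ x : ℕ → ℝ, (∀ i ≤ n, x i ∈ E) ∧
        ∀ i j, i ≤ j → j ≤ n → x i + ((j : ℝ) - i) * δ ≤ x j := by
  have hne : ∀ E : Set ℝ, 0 < volume.real E → E.Nonempty := by
    intro E h
    by_contra hE
    simp [not_nonempty_iff_eq_empty.1 hE] at h
  induction n with
  | zero =>
    intro E hE h
    obtain ⟨x, hx⟩ := hne E (by simpa using h)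
    refine ⟨fun _ => x, fun _ _ => hx, fun i j hij hj => ?_⟩
    obtain rfl : j = 0 := by omega
    obtain rfl : i = 0 := by omega
    simp
  | succ n ih =>
    intro E hE h
    have hn : 0 ≤ (n : ℝ) * δ := by positivity
    push_cast at h
    have hEne := hne E (by linarith)
    have hbdd : BddBelow E := ⟨u, fun x hx => (hE hx).1⟩
    obtain ⟨x₀, hx₀, hlt⟩ := Real.lt_sInf_add_pos hEne
      (show 0 < volume.real E - (n + 1) * δ by linarith)
    set a := sInf E
    have ha : a ≤ x₀ := csInf_le hbdd hx₀
    have hsub : E ⊆ (E ∩ Ici (x₀ + δ)) ∪ Icc a (x₀ + δ) := by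
      intro y hy
      rcases le_total (x₀ + δ) y with h | h
      · exact Or.inl ⟨hy, h⟩
      · exact Or.inr ⟨csInf_le hbdd hy, h⟩
    have hfin : volume ((E ∩ Ici (x₀ + δ)) ∪ Icc a (x₀ + δ)) ≠ ⊤ := by
      refine ((measure_mono (union_subset_union_left _
        (inter_subset_left.trans hE))).trans_lt (measure_union_lt_top ?_ ?_)).ne <;> simp
    have h1 := (measureReal_mono hsub hfin).trans (measureReal_union_le _ _)
    rw [Real.volume_real_Icc_of_le (by linarith)] at h1
    obtain ⟨y, hyE, hy⟩ := ih (E ∩ Ici (x₀ + δ)) (inter_subset_left.trans hE) (by linarith)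
    refine ⟨fun i => Nat.casesOn i x₀ y, ?_, ?_⟩
    · rintro (_ | i) hi
      · exact hx₀
      · exact (hyE i (by omega)).1
    · rintro (_ | i) (_ | j) hij hj
      · simp
      · have h2 := hy 0 j (by omega) (by omega)
        have h3 : x₀ + δ ≤ y 0 := (hyE 0 (by omega)).2
        push_cast at h2 ⊢
        change x₀ + _ ≤ y j
        linarith
      · omega
      · have h2 := hy i j (by omega) (by omega)
        push_cast
        simpa using h2

lemma prod_erase_range_abs_sub (k n : ℕ) (hk : k ≤ n) :
    ∏ j ∈ (Finset.range (n + 1)).erase k, |(k : ℝ) - j| = k.factorial * (n - k).factorial := by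
  induction n, hk using Nat.le_induction with
  | base =>
    rw [Finset.range_add_one, Finset.erase_insert (by simp), ← Finset.prod_range_reflect,
      ← Finset.prod_range_add_one_eq_factorial]
    push_cast
    simp only [tsub_self, Nat.factorial_zero, Nat.cast_one, mul_one]
    refine Finset.prod_congr rfl fun j hj => ?_
    have : j + 1 ≤ k := Finset.mem_range.1 hj
    rw [Nat.cast_sub (by omega), Nat.cast_sub (by omega)]
    push_cast
    rw [abs_of_nonneg] <;> linarith
  | succ n hkn ih =>
    rw [Finset.range_add_one, Finset.erase_insert_of_ne (by omega), Finset.prod_insert (by simp),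
      ih, Nat.succ_sub hkn, Nat.factorial_succ, abs_sub_comm, abs_of_nonneg]
    · push_cast [Nat.cast_sub hkn]; ring
    · have : (k : ℝ) ≤ n := by exact_mod_cast hkn
      push_cast; linarith

/-- A Remez-type inequality for complex polynomials on a set of positive measure. -/
lemma exists_norm_eval_le_of_volume_pos {u v ℓ x₀ : ℝ} {E : Set ℝ} (hE : E ⊆ Icc u v)
    (hpos : 0 < volume.real E) (hℓ : ∀ y ∈ E, |x₀ - y| ≤ ℓ) (P : Polynomial ℂ) (n : ℕ)
    (hP : P.natDegree ≤ n) :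
    ∃ y ∈ E, ‖P.eval (x₀ : ℂ)‖ ≤
      (4 * Real.exp 1 * ℓ / volume.real E) ^ n * ‖P.eval (y : ℂ)‖ := by
  set V := volume.real E
  rcases Nat.eq_zero_or_pos n with rfl | hn
  · obtain ⟨x, hx, -⟩ := exists_separated_points (δ := 0) le_rfl 0 E hE (by simpa using hpos)
    refine ⟨x 0, hx 0 le_rfl, ?_⟩
    rw [Polynomial.eq_C_of_natDegree_le_zero hP]
    simp
  have hn' : (0 : ℝ) < n := by exact_mod_cast hn
  set δ := V / (2 * n) with hδdef
  have hδ : 0 < δ := by positivity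
  obtain ⟨x, hxE, hx⟩ := exists_separated_points hδ.le n E hE (by
    rw [hδdef]; field_simp; change V < 2 * V; linarith)
  have hℓ0 : 0 ≤ ℓ := (abs_nonneg _).trans (hℓ _ (hxE 0 (by omega)))
  have hsep : ∀ i ≤ n, ∀ j ≤ n, |(i : ℝ) - j| * δ ≤ |x i - x j| := by
    intro i hi j hj
    rcases le_total i j with h | h
    · have := hx i j h hj
      have hc : (i : ℝ) ≤ j := by exact_mod_cast h
      rw [abs_of_nonpos (by linarith)]
      refine le_trans ?_ (neg_le_abs _)
      linarith
    · have := hx j i h hi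
      have hc : (j : ℝ) ≤ i := by exact_mod_cast h
      rw [abs_of_nonneg (by linarith)]
      refine le_trans ?_ (le_abs_self _)
      linarith
  obtain ⟨k, hk, hmax⟩ := Finset.exists_max_image (Finset.range (n + 1))
    (fun k => ‖P.eval (x k : ℂ)‖) ⟨0, by simp⟩
  rw [Finset.mem_range] at hk
  refine ⟨x k, hxE k (by omega), ?_⟩
  have hinj : Set.InjOn (fun i => (x i : ℂ)) (Finset.range (n + 1)) := by
    intro i hi j hj hij
    simp only [Finset.coe_range, mem_Iio] at hi hj
    have h1 := hsep i (by omega) j (by omega)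
    have h2 : x i = x j := Complex.ofReal_injective hij
    rw [h2, sub_self, abs_zero] at h1
    have h3 : |(i : ℝ) - j| = 0 :=
      le_antisymm (nonpos_of_mul_nonpos_left h1 hδ) (abs_nonneg _)
    exact_mod_cast sub_eq_zero.1 (abs_eq_zero.1 h3)
  have hdeg : P.degree < (Finset.range (n + 1)).card := by
    rw [Finset.card_range]
    exact lt_of_le_of_lt Polynomial.degree_le_natDegree (by exact_mod_cast Nat.lt_succ_of_le hP)
  have hbasis : ∀ i ∈ Finset.range (n + 1),
      ‖(Lagrange.basis (Finset.range (n + 1)) (fun i => (x i : ℂ)) i).eval (x₀ : ℂ)‖ ≤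
        (ℓ / δ) ^ n * ((n.choose i : ℝ) / n.factorial) := by
    intro i hi
    have hi' : i ≤ n := by simpa [Nat.lt_succ_iff] using hi
    have hch : (n.choose i : ℝ) / n.factorial =
        (∏ j ∈ (Finset.range (n + 1)).erase i, |(i : ℝ) - j|)⁻¹ := by
      rw [prod_erase_range_abs_sub i n hi', Nat.cast_choose ℝ hi']
      have := Nat.factorial_ne_zero n
      field_simp
    have hpow : (ℓ / δ) ^ n = ∏ j ∈ (Finset.range (n + 1)).erase i, (ℓ / δ) := by
      rw [Finset.prod_const, Finset.card_erase_of_mem hi, Finset.card_range, Nat.add_sub_cancel]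
    rw [hch, hpow, ← Finset.prod_inv_distrib, ← Finset.prod_mul_distrib, Lagrange.basis,
      Polynomial.eval_prod, norm_prod]
    refine Finset.prod_le_prod (fun _ _ => norm_nonneg _) fun j hj => ?_
    obtain ⟨hji, hj⟩ := Finset.mem_erase.1 hj
    have hj' : j ≤ n := by simpa [Nat.lt_succ_iff] using hj
    have hne : 0 < |(i : ℝ) - j| := abs_pos.2 (sub_ne_zero.2 (by exact_mod_cast hji.symm))
    have h1 : ‖(x₀ : ℂ) - x j‖ ≤ ℓ := by
      rw [← Complex.ofReal_sub, Complex.norm_real]; exact hℓ _ (hxE j hj')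
    have h2 : |(i : ℝ) - j| * δ ≤ ‖(x i : ℂ) - x j‖ := by
      rw [← Complex.ofReal_sub, Complex.norm_real]; exact hsep i hi' j hj'
    rw [Lagrange.basisDivisor]
    simp only [Polynomial.eval_mul, Polynomial.eval_C, Polynomial.eval_sub, Polynomial.eval_X,
      norm_mul, norm_inv]
    calc ‖(x i : ℂ) - x j‖⁻¹ * ‖(x₀ : ℂ) - x j‖
        ≤ (|(i : ℝ) - j| * δ)⁻¹ * ℓ := by gcongr
      _ = ℓ / δ * |(i : ℝ) - j|⁻¹ := by field_simp
  have hsum : ∑ i ∈ Finset.range (n + 1), (ℓ / δ) ^ n * ((n.choose i : ℝ) / n.factorial)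
      = (4 * ℓ / V) ^ n * ((n : ℝ) ^ n / n.factorial) := by
    rw [← Finset.mul_sum, ← Finset.sum_div, ← Nat.cast_sum, Nat.sum_range_choose]
    push_cast
    rw [← mul_div_assoc, ← mul_div_assoc, ← mul_pow, ← mul_pow, hδdef]
    congr 2
    field_simp
    norm_num
  have hexp : (n : ℝ) ^ n / n.factorial ≤ Real.exp 1 ^ n := by
    rw [← Real.exp_nat_mul, mul_one]
    exact Real.pow_div_factorial_le_exp _ hn'.le n
  calc ‖P.eval (x₀ : ℂ)‖
      = ‖∑ i ∈ Finset.range (n + 1), P.eval (x i : ℂ) *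
          (Lagrange.basis (Finset.range (n + 1)) (fun i => (x i : ℂ)) i).eval (x₀ : ℂ)‖ := by
        conv_lhs => rw [Lagrange.eq_interpolate hinj hdeg, Lagrange.interpolate_apply,
          Polynomial.eval_finsetSum]
        simp
    _ ≤ ∑ i ∈ Finset.range (n + 1), ‖P.eval (x k : ℂ)‖ *
          ((ℓ / δ) ^ n * ((n.choose i : ℝ) / n.factorial)) := by
        refine (norm_sum_le _ _).trans (Finset.sum_le_sum fun i hi => ?_)
        rw [norm_mul]
        exact mul_le_mul (hmax i hi) (hbasis i hi) (norm_nonneg _) (norm_nonneg _)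
    _ = (4 * ℓ / V) ^ n * ((n : ℝ) ^ n / n.factorial) * ‖P.eval (x k : ℂ)‖ := by
        rw [← Finset.mul_sum, hsum, mul_comm]
    _ ≤ (4 * ℓ / V) ^ n * Real.exp 1 ^ n * ‖P.eval (x k : ℂ)‖ := by gcongr
    _ = (4 * Real.exp 1 * ℓ / V) ^ n * ‖P.eval (x k : ℂ)‖ := by
        rw [← mul_pow]; congr 2; ring

/-- A zero-free holomorphic function on the disc of radius `2` bounded by `M` satisfies
a Harnack-type lower bound on the closed unit disc. -/
lemma norm_zero_pow_three_le_of_ne_zero {g : ℂ → ℂ} {M : ℝ}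
    (hg : DifferentiableOn ℂ g (Metric.ball 0 2)) (h0 : ∀ z ∈ Metric.ball (0 : ℂ) 2, g z ≠ 0)
    (hM : ∀ z ∈ Metric.ball (0 : ℂ) 2, ‖g z‖ ≤ M) {y : ℂ} (hy : ‖y‖ ≤ 1) :
    ‖g 0‖ ^ 3 ≤ M ^ 2 * ‖g y‖ := by
  have hb : (0 : ℂ) ∈ Metric.ball (0 : ℂ) 2 := by simp
  have hyb : y ∈ Metric.ball (0 : ℂ) 2 := by simp; linarith
  have hg0 : 0 < ‖g 0‖ := norm_pos_iff.2 (h0 0 hb)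
  have hM0 : 0 < M := hg0.trans_le (hM 0 hb)
  obtain ⟨h, hh0, hh⟩ := ((hg.deriv Metric.isOpen_ball).div hg h0).isExactOn_ball.with_val_at 0 0
  have hconst : ∀ z ∈ Metric.ball (0 : ℂ) 2, g z = g 0 * Complex.exp (h z) := by
    have hd : ∀ z ∈ Metric.ball (0 : ℂ) 2,
        HasDerivAt (fun z => g z * Complex.exp (-h z)) 0 z := by
      intro z hz
      have h1 := (hg.differentiableAt (Metric.isOpen_ball.mem_nhds hz)).hasDerivAt
      have h2 := h1.mul (hh z hz).neg.cexp
      have := h0 z hz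
      refine h2.congr_deriv ?_
      simp only [Pi.div_apply, Pi.neg_apply]
      field_simp
      ring
    intro z hz
    have h3 := Metric.isOpen_ball.is_const_of_deriv_eq_zero
      (convex_ball (0 : ℂ) 2).isPreconnected
      (fun z hz => (hd z hz).differentiableAt.differentiableWithinAt)
      (fun z hz => (hd z hz).deriv) hz hb
    simp only [hh0, neg_zero, Complex.exp_zero, mul_one] at h3
    rw [← h3, mul_assoc, ← Complex.exp_add]
    simp
  have hnorm : ∀ z ∈ Metric.ball (0 : ℂ) 2, ‖g z‖ = ‖g 0‖ * Real.exp (h z).re := by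
    intro z hz
    rw [hconst z hz, norm_mul, Complex.norm_exp]
  set A := Real.log (M / ‖g 0‖) with hA
  have hexpA : Real.exp A = M / ‖g 0‖ := Real.exp_log (by positivity)
  have hA0 : 0 ≤ A := Real.log_nonneg ((one_le_div hg0).2 (hM 0 hb))
  have hre : ∀ z ∈ Metric.ball (0 : ℂ) 2, (h z).re ≤ A := by
    intro z hz
    rw [hA, Real.le_log_iff_exp_le (by positivity), le_div_iff₀ hg0, mul_comm, ← hnorm z hz]
    exact hM z hz
  have hbound : ‖h y‖ ≤ 2 * A := by
    refine le_of_forall_pos_le_add fun ε hε => ?_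
    have hBC := Complex.borelCaratheodory_zero (M := A + ε / 2) (f := h) (R := 2) (z := y)
      (by linarith)
      (fun z hz => (hh z hz).differentiableAt.differentiableWithinAt)
      (fun z hz => (hre z hz).trans (by linarith)) two_pos hyb hh0
    refine hBC.trans ?_
    rw [div_le_iff₀ (by linarith)]
    nlinarith [norm_nonneg y]
  have hlow : -(2 * A) ≤ (h y).re := by
    linarith [Complex.abs_re_le_norm (h y), neg_le_abs (h y).re]
  have hexp := Real.exp_le_exp.2 hlow
  rw [Real.exp_neg, two_mul, Real.exp_add, hexpA] at hexp
  rw [hnorm y hyb]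
  calc ‖g 0‖ ^ 3 = M ^ 2 * (‖g 0‖ * (M / ‖g 0‖ * (M / ‖g 0‖))⁻¹) := by field_simp
    _ ≤ _ := by gcongr

/-- Dividing a holomorphic function by the Blaschke factor (for the disc of radius `4`) of one
of its zeros in the disc of radius `2`. -/
lemma exists_eq_blaschke_mul {g : ℂ → ℂ} {M : ℝ} {a : ℂ}
    (hg : DiffContOnCl ℂ g (Metric.ball 0 4)) (hM : ∀ z ∈ Metric.closedBall (0 : ℂ) 4, ‖g z‖ ≤ M)
    (ha : ‖a‖ < 2) (hga : g a = 0) :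
    ∃ g' : ℂ → ℂ, DiffContOnCl ℂ g' (Metric.ball 0 4) ∧
      (∀ z ∈ Metric.closedBall (0 : ℂ) 4, ‖g' z‖ ≤ M) ∧
      ∀ z, 4 * (z - a) * g' z = (16 - starRingEnd ℂ a * z) * g z := by
  have hclos : closure (Metric.ball (0 : ℂ) 4) = Metric.closedBall 0 4 :=
    closure_ball _ (by norm_num)
  have hab : a ∈ Metric.ball (0 : ℂ) 4 := by simp; linarith
  have hnh : Metric.ball (0 : ℂ) 4 ∈ nhds a := Metric.isOpen_ball.mem_nhds hab
  have heq : ∀ z, 4 * (z - a) * ((16 - starRingEnd ℂ a * z) / 4 * dslope g a z) =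
      (16 - starRingEnd ℂ a * z) * g z := by
    intro z
    have h1 := sub_smul_dslope g a z
    rw [hga, sub_zero, smul_eq_mul] at h1
    rw [← h1]; ring
  have hds : DiffContOnCl ℂ (fun z => (16 - starRingEnd ℂ a * z) / 4 * dslope g a z)
      (Metric.ball 0 4) := by
    refine ⟨DifferentiableOn.mul (by fun_prop)
      ((Complex.differentiableOn_dslope hnh).2 hg.differentiableOn),
      ContinuousOn.mul (by fun_prop)
      ((continuousOn_dslope (Filter.mem_of_superset hnh subset_closure)).2
        ⟨hg.continuousOn, hg.differentiableOn.differentiableAt hnh⟩)⟩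
  refine ⟨_, hds, fun z hz => ?_, heq⟩
  refine Complex.norm_le_of_forall_mem_frontier_norm_le Metric.isBounded_ball hds
    (fun w hw => ?_) (by rwa [hclos])
  rw [frontier_ball _ (by norm_num), mem_sphere_zero_iff_norm] at hw
  have hwa : 0 < ‖w - a‖ := by
    have := norm_sub_norm_le w a
    linarith
  have hB : ‖16 - starRingEnd ℂ a * w‖ = 4 * ‖w - a‖ := by
    have h16 : (16 : ℂ) = starRingEnd ℂ w * w := by
      rw [mul_comm, Complex.mul_conj, Complex.normSq_eq_norm_sq, hw]; norm_num
    rw [h16, ← sub_mul, ← map_sub, norm_mul, Complex.norm_conj, hw, mul_comm]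
  have h2 := congrArg norm (heq w)
  rw [norm_mul, norm_mul _ (g w), hB, norm_mul, show ‖(4 : ℂ)‖ = 4 by simp] at h2
  have h3 := mul_left_cancel₀ (by positivity) h2
  rw [h3]
  exact hM w (by simp [hw])

/-- A holomorphic function on the disc of radius `4` bounded by `M` is comparable on the unit
disc to a polynomial whose degree is controlled by `M`. -/
lemma exists_polynomial_norm_comparison {f : ℂ → ℂ} {M : ℝ}
    (hf : DiffContOnCl ℂ f (Metric.ball 0 4)) (hM : ∀ z ∈ Metric.closedBall (0 : ℂ) 4, ‖f z‖ ≤ M)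
    (hf0 : f 0 ≠ 0) :
    ∃ (n : ℕ) (P : Polynomial ℂ), P.natDegree ≤ n ∧ P.eval 0 ≠ 0 ∧ 2 ^ n * ‖f 0‖ ≤ M ∧
      ∀ y : ℂ, ‖y‖ ≤ 1 → ‖f 0‖ * ‖P.eval y‖ * (2 ^ n * ‖f 0‖) ^ 2 ≤
        (9 / 8) ^ n * M ^ 2 * ‖f y‖ * ‖P.eval 0‖ := by
  have hf0' : 0 < ‖f 0‖ := norm_pos_iff.2 hf0
  let Q : ℕ → Prop := fun n => ∃ (g : ℂ → ℂ) (P : Polynomial ℂ),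
    DiffContOnCl ℂ g (Metric.ball 0 4) ∧ (∀ z ∈ Metric.closedBall (0 : ℂ) 4, ‖g z‖ ≤ M) ∧
    2 ^ n * ‖f 0‖ ≤ ‖g 0‖ ∧ P.natDegree ≤ n ∧ P.eval 0 ≠ 0 ∧
    ∀ y : ℂ, ‖y‖ ≤ 1 → ‖f 0‖ * ‖g y‖ * ‖P.eval y‖ ≤ (9 / 8) ^ n * ‖f y‖ * ‖g 0‖ * ‖P.eval 0‖
  have hQ0 : Q 0 := ⟨f, 1, hf, hM, by simp, by simp, by simp, fun y _ => by
    simp [mul_comm]⟩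
  have hQle : ∀ n, Q n → 2 ^ n * ‖f 0‖ ≤ M := by
    rintro n ⟨g, P, -, hgM, hg0, -⟩
    exact hg0.trans (hgM 0 (by simp))
  obtain ⟨N, hN⟩ : ∃ N : ℕ, ∀ n, Q n → n ≤ N := by
    obtain ⟨N, hN⟩ := pow_unbounded_of_one_lt (M / ‖f 0‖) (one_lt_two (α := ℝ))
    refine ⟨N, fun n hn => ?_⟩
    by_contra! hlt
    have h1 := (le_div_iff₀ hf0').2 (hQle n hn)
    have h2 : (2 : ℝ) ^ N ≤ 2 ^ n := pow_le_pow_right₀ one_le_two hlt.le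
    linarith
  obtain ⟨n, hn, hmax⟩ : ∃ n, Q n ∧ ¬ Q (n + 1) := by
    by_contra! hcon
    have hall : ∀ n, Q n := fun n => Nat.rec hQ0 hcon n
    exact absurd (hN _ (hall (N + 1))) (by omega)
  have hle := hQle n hn
  obtain ⟨g, P, hg, hgM, hg0, hdeg, hP0, hcomp⟩ := hn
  have hg0' : 0 < ‖g 0‖ := lt_of_lt_of_le (by positivity) hg0
  have hzero : ∀ z ∈ Metric.ball (0 : ℂ) 2, g z ≠ 0 := by
    intro a ha hga
    apply hmax
    rw [mem_ball_zero_iff] at ha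
    have hane : a ≠ 0 := by rintro rfl; simp [hga] at hg0'
    have hapos : 0 < ‖a‖ := norm_pos_iff.2 hane
    obtain ⟨g', hg', hgM', heq⟩ := exists_eq_blaschke_mul hg hgM ha hga
    have heq0 : ‖a‖ * ‖g' 0‖ = 4 * ‖g 0‖ := by
      have := congrArg norm (heq 0)
      simp only [zero_sub, mul_zero, sub_zero, norm_mul, norm_neg, Complex.norm_ofNat] at this
      linarith
    refine ⟨g', P * (Polynomial.X - Polynomial.C a), hg', hgM', ?_, ?_, ?_, ?_⟩
    · rw [pow_succ]
      nlinarith [norm_nonneg (g' 0)]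
    · refine Polynomial.natDegree_mul_le.trans ?_
      rw [Polynomial.natDegree_X_sub_C]
      omega
    · simp [hP0, hane]
    · intro y hy
      have h1 := hcomp y hy
      have h2 := congrArg norm (heq y)
      simp only [norm_mul, Complex.norm_ofNat] at h2
      have h3 : ‖16 - starRingEnd ℂ a * y‖ ≤ 18 := by
        refine (norm_sub_le _ _).trans ?_
        rw [norm_mul, Complex.norm_conj, Complex.norm_ofNat]
        nlinarith [norm_nonneg a, norm_nonneg y]
      simp only [Polynomial.eval_mul, Polynomial.eval_sub, Polynomial.eval_X, Polynomial.eval_C,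
        norm_mul, zero_sub, norm_neg]
      calc ‖f 0‖ * ‖g' y‖ * (‖P.eval y‖ * ‖y - a‖)
          = ‖f 0‖ * ‖P.eval y‖ * (4 * ‖y - a‖ * ‖g' y‖) / 4 := by ring
        _ = ‖16 - starRingEnd ℂ a * y‖ / 4 * (‖f 0‖ * ‖g y‖ * ‖P.eval y‖) := by rw [h2]; ring
        _ ≤ 18 / 4 * ((9 / 8) ^ n * ‖f y‖ * ‖g 0‖ * ‖P.eval 0‖) := by gcongr
        _ = 9 / 8 * (9 / 8) ^ n * ‖f y‖ * (4 * ‖g 0‖) * ‖P.eval 0‖ := by ring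
        _ = _ := by rw [← heq0, pow_succ]; ring
  refine ⟨n, P, hdeg, hP0, hle, fun y hy => ?_⟩
  have hsub : Metric.ball (0 : ℂ) 2 ⊆ Metric.ball 0 4 := Metric.ball_subset_ball (by norm_num)
  have hlow := norm_zero_pow_three_le_of_ne_zero (hg.differentiableOn.mono hsub) hzero
    (fun z hz => hgM z (Metric.ball_subset_closedBall (hsub hz))) hy
  have h1 := hcomp y hy
  refine le_of_mul_le_mul_right ?_ hg0'
  calc ‖f 0‖ * ‖P.eval y‖ * (2 ^ n * ‖f 0‖) ^ 2 * ‖g 0‖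
      ≤ ‖f 0‖ * ‖P.eval y‖ * ‖g 0‖ ^ 2 * ‖g 0‖ := by gcongr
    _ = ‖f 0‖ * ‖P.eval y‖ * ‖g 0‖ ^ 3 := by ring
    _ ≤ ‖f 0‖ * ‖P.eval y‖ * (M ^ 2 * ‖g y‖) := by gcongr
    _ = M ^ 2 * (‖f 0‖ * ‖g y‖ * ‖P.eval y‖) := by ring
    _ ≤ M ^ 2 * ((9 / 8) ^ n * ‖f y‖ * ‖g 0‖ * ‖P.eval 0‖) := by gcongr
    _ = _ := by ring

/-- Evaluation of an analytic function at a maximum point of an interval is controlled by some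
value on any subset of positive measure. -/
lemma exists_mem_le_rpow_mul_norm {u v : ℝ} {E : Set ℝ}
    (hE : E ⊆ Icc u v) (hpos : 0 < volume.real E) {Φ : ℂ → ℂ} {M x₀ : ℝ} (hx₀ : x₀ ∈ Icc u v)
    (hΦ : DifferentiableOn ℂ Φ (Metric.closedBall (x₀ : ℂ) (4 * (v - u))))
    (hM : ∀ z ∈ Metric.closedBall (x₀ : ℂ) (4 * (v - u)), ‖Φ z‖ ≤ M)
    (hm0 : 0 < ‖Φ x₀‖) :
    ∃ y ∈ E, ‖Φ x₀‖ ≤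
      (13 * (v - u) / volume.real E) ^ (Real.log (M / ‖Φ x₀‖) / Real.log 2) * ‖Φ y‖ := by
  set ℓ := v - u with hℓ
  set V := volume.real E
  set m := ‖Φ x₀‖ with hm
  have hVℓ : V ≤ ℓ := by
    have h1 : V ≤ volume.real (Icc u v) := measureReal_mono hE (by simp)
    rwa [Real.volume_real_Icc_of_le (hx₀.1.trans hx₀.2)] at h1
  have hℓ0 : 0 < ℓ := hpos.trans_le hVℓ
  have hmaps : MapsTo (fun z : ℂ => x₀ + ℓ * z) (Metric.closedBall 0 4)
      (Metric.closedBall (x₀ : ℂ) (4 * ℓ)) := by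
    intro z hz
    rw [mem_closedBall_zero_iff] at hz
    rw [mem_closedBall_iff_norm, add_sub_cancel_left, norm_mul, Complex.norm_real,
      Real.norm_of_nonneg hℓ0.le]
    nlinarith
  have hdiff : DiffContOnCl ℂ (fun z : ℂ => Φ (x₀ + ℓ * z)) (Metric.ball 0 4) := by
    apply DifferentiableOn.diffContOnCl
    rw [closure_ball _ (by norm_num)]
    exact hΦ.comp (by fun_prop) hmaps
  obtain ⟨n, P, hdeg, hP0, hnM, hcomp⟩ := exists_polynomial_norm_comparison hdiff
    (fun z hz => hM _ (hmaps hz)) (by simpa [hm] using hm0)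
  simp only [mul_zero, add_zero, ← hm] at hnM hcomp
  have hdist : ∀ y ∈ E, |x₀ - y| ≤ ℓ := fun y hy => by
    have := hE hy
    rw [abs_le]
    constructor <;> linarith [hx₀.1, hx₀.2, this.1, this.2]
  obtain ⟨y, hy, hR⟩ := exists_norm_eval_le_of_volume_pos hE hpos hdist
    (P.comp (Polynomial.C (ℓ : ℂ)⁻¹ * (Polynomial.X - Polynomial.C (x₀ : ℂ)))) n (by
      refine Polynomial.natDegree_comp_le.trans ?_
      have : (Polynomial.C (ℓ : ℂ)⁻¹ * (Polynomial.X - Polynomial.C (x₀ : ℂ))).natDegree ≤ 1 :=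
        (Polynomial.natDegree_C_mul_le _ _).trans (Polynomial.natDegree_X_sub_C_le _)
      nlinarith)
  refine ⟨y, hy, ?_⟩
  simp only [Polynomial.eval_comp, Polynomial.eval_mul, Polynomial.eval_C, Polynomial.eval_sub,
    Polynomial.eval_X, sub_self, mul_zero] at hR
  have hℓc : (ℓ : ℂ) ≠ 0 := by exact_mod_cast hℓ0.ne'
  have hw : ‖(ℓ : ℂ)⁻¹ * (y - x₀)‖ ≤ 1 := by
    rw [norm_mul, norm_inv, ← Complex.ofReal_sub, Complex.norm_real, Complex.norm_real,
      Real.norm_of_nonneg hℓ0.le, Real.norm_eq_abs, abs_sub_comm]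
    exact inv_mul_le_one_of_le₀ (hdist y hy) hℓ0.le
  have hc := hcomp _ hw
  rw [show (x₀ : ℂ) + ℓ * ((ℓ : ℂ)⁻¹ * (y - x₀)) = y by field_simp; ring] at hc
  set p := ‖P.eval ((ℓ : ℂ)⁻¹ * (y - x₀))‖
  set R := 4 * Real.exp 1 * ℓ / V with hRdef
  have hR0 : 0 < R := by positivity
  have hP0' : 0 < ‖P.eval 0‖ := norm_pos_iff.2 hP0
  have hp : 0 < p := pos_of_mul_pos_right (hP0'.trans_le hR) (by positivity)
  have hM0 : 0 < M := lt_of_lt_of_le (by positivity) hnM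
  have h1 : m * (2 ^ n * m) ^ 2 ≤ (9 / 8) ^ n * R ^ n * M ^ 2 * ‖Φ y‖ := by
    refine le_of_mul_le_mul_right ?_ hp
    calc m * (2 ^ n * m) ^ 2 * p = m * p * (2 ^ n * m) ^ 2 := by ring
      _ ≤ (9 / 8) ^ n * M ^ 2 * ‖Φ y‖ * ‖P.eval 0‖ := hc
      _ ≤ (9 / 8) ^ n * M ^ 2 * ‖Φ y‖ * (R ^ n * p) := by gcongr
      _ = _ := by ring
  set L := Real.log (M / m) / Real.log 2
  have hlog2 : 0 < Real.log 2 := Real.log_pos one_lt_two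
  have hκ : M / m = 2 ^ L := by
    rw [Real.rpow_def_of_pos two_pos, mul_div_cancel₀ _ hlog2.ne', Real.exp_log (by positivity)]
  have hnL : (n : ℝ) ≤ L := by
    have h2 : (2 : ℝ) ^ (n : ℝ) ≤ 2 ^ L := by
      rw [← hκ, Real.rpow_natCast]
      exact (le_div_iff₀ hm0).2 hnM
    exact (Real.rpow_le_rpow_left_iff one_lt_two).1 h2
  have hT : 1 ≤ ℓ / V := (one_le_div hpos).2 hVℓ
  have hR' : 9 / 32 * R ≤ 13 / 4 * (ℓ / V) := by
    rw [hRdef, mul_div_assoc]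
    nlinarith [Real.exp_one_lt_d9]
  have h3 : (9 / 32 * R) ^ n ≤ (13 / 4 * (ℓ / V)) ^ L := by
    calc (9 / 32 * R) ^ n ≤ (13 / 4 * (ℓ / V)) ^ n := by gcongr
      _ = (13 / 4 * (ℓ / V)) ^ (n : ℝ) := (Real.rpow_natCast _ _).symm
      _ ≤ _ := Real.rpow_le_rpow_of_exponent_le (by linarith) hnL
  calc m = (m * (2 ^ n * m) ^ 2) / ((2 ^ n) ^ 2 * m ^ 2) := by field_simp
    _ ≤ ((9 / 8) ^ n * R ^ n * M ^ 2 * ‖Φ y‖) / ((2 ^ n) ^ 2 * m ^ 2) := by gcongr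
    _ = (M / m) ^ 2 * (9 / 32 * R) ^ n * ‖Φ y‖ := by
      rw [show (9 / 32 * R) = 9 / 8 * R / (2 ^ 2) by ring, div_pow (9 / 8 * R), mul_pow (9 / 8),
        ← pow_mul, ← pow_mul, mul_comm n 2]
      field_simp
    _ ≤ (M / m) ^ 2 * (13 / 4 * (ℓ / V)) ^ L * ‖Φ y‖ := by gcongr
    _ = (13 * ℓ / V) ^ L * ‖Φ y‖ := by
      rw [hκ, ← Real.rpow_mul_natCast two_pos.le, mul_comm L, Real.rpow_mul two_pos.le,
        ← Real.mul_rpow (by positivity) (by positivity)]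
      congr 2
      push_cast
      norm_num
      ring

/-- At least half of a set of finite measure consists of points where an integrable nonnegative
function is at most twice its average. -/
lemma half_volume_le_volume_sublevel {J : Set ℝ} (hJm : MeasurableSet J)
    (hJpos : 0 < volume.real J) {F : ℝ → ℝ} (hF0 : ∀ x, 0 ≤ F x) (hF : IntegrableOn F J)
    (hI : 0 < ∫ s in J, F s) :
    volume.real J / 2 ≤ volume.real {x ∈ J | F x ≤ 2 / volume.real J * ∫ s in J, F s} := by
  set c := 2 / volume.real J * ∫ s in J, F s with hc
  have hc0 : 0 < c := by positivity
  have hJfin : volume J ≠ ⊤ := fun h => by simp [Measure.real, h] at hJpos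
  have hmk := mul_meas_ge_le_integral_of_nonneg (ae_of_all (volume.restrict J) hF0) hF c
  rw [measureReal_def, Measure.restrict_apply' hJm, ← measureReal_def] at hmk
  have h1 : volume.real ({x | c ≤ F x} ∩ J) ≤ volume.real J / 2 := by
    refine le_of_mul_le_mul_left (hmk.trans_eq ?_) hc0
    rw [hc]; field_simp
  have hsub : J ⊆ {x ∈ J | F x ≤ c} ∪ ({x | c ≤ F x} ∩ J) := fun x hx =>
    (le_total (F x) c).imp (fun h => ⟨hx, h⟩) fun h => ⟨h, hx⟩
  have h2 := (measureReal_mono hsub (measure_ne_top_of_subset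
    (union_subset (sep_subset _ _) inter_subset_right) hJfin)).trans (measureReal_union_le _ _)
  linarith

/-- Kovrijkine's lemma: a quantitative estimate for analytic functions on an
interval `I = [u,v]` in terms of their values on a subset `J` of positive
measure.  Here `D_I = {z : dist(z,I) ≤ 4|I|}`, `M = max_{D_I} |Φ|` and
`m = max_I |Φ|`. -/
theorem kovrijkine_estimate
    {u v : ℝ} (huv : u < v) {J : Set ℝ} (hJm : MeasurableSet J)
    (hJI : J ⊆ Set.Icc u v) (hJpos : 0 < (volume J).toReal)
    (Φ : ℂ → ℂ)
    (hΦ : ∀ z ∈ {z : ℂ | Metric.infDist z ((fun x : ℝ => (x:ℂ)) '' Set.Icc u v) ≤ 4*(v-u)},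
      AnalyticAt ℂ Φ z)
    {M m : ℝ}
    (hM : IsGreatest ((fun z => ‖Φ z‖) ''
      {z : ℂ | Metric.infDist z ((fun x : ℝ => (x:ℂ)) '' Set.Icc u v) ≤ 4*(v-u)}) M)
    (hm : IsGreatest ((fun x : ℝ => ‖Φ ((x:ℝ):ℂ)‖) '' Set.Icc u v) m)
    (hm0 : 0 < m) :
    (∫ s in Set.Icc u v, ‖Φ ((s:ℝ):ℂ)‖^2) ≤
      (300 * (v-u) / (volume J).toReal) ^ (2 * Real.log (M/m) / Real.log 2 + 1) *
        ∫ s in J, ‖Φ ((s:ℝ):ℂ)‖^2 := by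
  obtain ⟨⟨x₀, hx₀, hx₀m⟩, hmax⟩ := hm
  simp only at hx₀m
  set ℓ := v - u with hℓ
  have hℓ0 : 0 < ℓ := sub_pos.2 huv
  have hsub : Metric.closedBall (x₀ : ℂ) (4 * ℓ) ⊆
      {z : ℂ | Metric.infDist z ((fun x : ℝ => (x : ℂ)) '' Set.Icc u v) ≤ 4 * ℓ} :=
    fun z hz => (Metric.infDist_le_dist_of_mem (mem_image_of_mem _ hx₀)).trans hz
  have hdiff : DifferentiableOn ℂ Φ (Metric.closedBall (x₀ : ℂ) (4 * ℓ)) :=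
    fun z hz => (hΦ z (hsub hz)).differentiableAt.differentiableWithinAt
  have hbd : ∀ z ∈ Metric.closedBall (x₀ : ℂ) (4 * ℓ), ‖Φ z‖ ≤ M :=
    fun z hz => hM.2 (mem_image_of_mem _ (hsub hz))
  have hmM : m ≤ M := hx₀m ▸ hbd _ (Metric.mem_closedBall_self (by positivity))
  set L := Real.log (M / m) / Real.log 2 with hL
  have hL0 : 0 ≤ L :=
    div_nonneg (Real.log_nonneg ((one_le_div hm0).2 hmM)) (Real.log_nonneg one_le_two)
  have key : ∀ E ⊆ J, 0 < volume.real E →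
      ∃ y ∈ E, m ≤ (13 * ℓ / volume.real E) ^ L * ‖Φ ((y : ℝ) : ℂ)‖ := by
    intro E hEJ hE
    have := exists_mem_le_rpow_mul_norm (hEJ.trans hJI) hE hx₀ hdiff hbd (hx₀m ▸ hm0)
    rwa [hx₀m] at this
  change 0 < volume.real J at hJpos
  change _ ≤ (300 * ℓ / volume.real J) ^ _ * _
  set V := volume.real J with hV
  have hJfin : volume J ≠ ⊤ := fun h => by simp [hV, Measure.real, h] at hJpos
  have hcont : ContinuousOn (fun s : ℝ => ‖Φ ((s : ℝ) : ℂ)‖ ^ 2) (Icc u v) := by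
    intro s hs
    have h1 : ContinuousAt Φ (s : ℂ) := (hΦ s (by
      change Metric.infDist _ _ ≤ _
      rw [Metric.infDist_zero_of_mem (mem_image_of_mem _ hs)]
      positivity)).continuousAt
    exact ((h1.comp Complex.continuous_ofReal.continuousAt).norm.pow 2).continuousWithinAt
  have hint := hcont.integrableOn_Icc (μ := volume)
  have hintJ := hint.mono_set hJI
  have hJ0 : 0 < ∫ s in J, ‖Φ ((s : ℝ) : ℂ)‖ ^ 2 := by
    refine (integral_nonneg fun s => sq_nonneg _).lt_of_ne fun h => ?_
    have hE := measure_le_setAverage_pos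
      (fun h => by simp [hV, Measure.real, h] at hJpos) hJfin hintJ
    rw [setAverage_eq, ← h, smul_zero] at hE
    obtain ⟨y, ⟨-, hy⟩, hle⟩ := key _ (sep_subset _ _)
      (ENNReal.toReal_pos hE.ne' (measure_ne_top_of_subset (sep_subset _ _) hJfin))
    have hy0 : ‖Φ (y : ℂ)‖ = 0 := pow_eq_zero_iff two_ne_zero |>.1 (le_antisymm hy (sq_nonneg _))
    rw [hy0, mul_zero] at hle
    linarith
  have hhalf := half_volume_le_volume_sublevel hJm hJpos (fun s => sq_nonneg _) hintJ hJ0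
  set I := ∫ s in J, ‖Φ ((s : ℝ) : ℂ)‖ ^ 2
  have hEpos : 0 < volume.real {x ∈ J | ‖Φ ((x : ℝ) : ℂ)‖ ^ 2 ≤ 2 / V * I} :=
    (half_pos hJpos).trans_le hhalf
  obtain ⟨y, ⟨-, hy⟩, hle⟩ := key _ (sep_subset _ _) hEpos
  have hbase : 13 * ℓ / volume.real {x ∈ J | ‖Φ ((x : ℝ) : ℂ)‖ ^ 2 ≤ 2 / V * I} ≤
      300 * ℓ / V := by
    rw [div_le_div_iff₀ hEpos hJpos]
    nlinarith
  have hle' : m ≤ (300 * ℓ / V) ^ L * ‖Φ (y : ℂ)‖ := by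
    refine hle.trans ?_
    gcongr
  have hIcc : (∫ s in Icc u v, ‖Φ ((s : ℝ) : ℂ)‖ ^ 2) ≤ m ^ 2 * ℓ := by
    have h1 := setIntegral_mono_on hint (integrableOn_const (C := m ^ 2) (by simp))
      measurableSet_Icc (fun s hs =>
        pow_le_pow_left₀ (norm_nonneg _) (hmax (mem_image_of_mem _ hs)) 2)
    rwa [setIntegral_const, Real.volume_real_Icc_of_le huv.le, smul_eq_mul, mul_comm] at h1
  calc (∫ s in Icc u v, ‖Φ ((s : ℝ) : ℂ)‖ ^ 2) ≤ m ^ 2 * ℓ := hIcc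
    _ ≤ ((300 * ℓ / V) ^ L * ‖Φ (y : ℂ)‖) ^ 2 * ℓ := by gcongr
    _ = ((300 * ℓ / V) ^ L) ^ 2 * ‖Φ (y : ℂ)‖ ^ 2 * ℓ := by ring
    _ ≤ ((300 * ℓ / V) ^ L) ^ 2 * (2 / V * I) * ℓ := by gcongr
    _ = ((300 * ℓ / V) ^ L) ^ 2 * (2 * ℓ / V) * I := by ring
    _ ≤ ((300 * ℓ / V) ^ L) ^ 2 * (300 * ℓ / V) * I := by gcongr; norm_num
    _ = _ := by
      rw [Real.rpow_add_one (by positivity), ← Real.rpow_mul_natCast (by positivity), hL]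
      congr 3
      push_cast
      ring
end

section
/- Let α > −1/2. There exists a constant C_α > 0 (depending only on α) such that for all s > 0 and all a with 0 < a ≤ s: ∫_{{t ≥ 0 : |t−s| ≥ a}} ( t² j_{α+1}(t) / (t² − s²) )² dμ_α(t) ≤ C_α / a. -/
open MeasureTheory Real Set

/-- The coefficients of the entire function `besselEntire β`. -/
noncomputable def besselCoeff (β : ℝ) (n : ℕ) : ℝ :=
  (-1 : ℝ) ^ n / ((n.factorial : ℝ) * Gamma ((n : ℝ) + β + 1))

/-- The entire function `∑ (-1)^n y^n / (n! Γ(n+β+1))`, which is `j_β(x) / Γ(β+1)` at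
`y = (x/2)^2`. -/
noncomputable def besselEntire (β y : ℝ) : ℝ := ∑' n : ℕ, besselCoeff β n * y ^ n

theorem besselJ_eq (β x : ℝ) : besselJ β x = Gamma (β + 1) * besselEntire β ((x / 2) ^ 2) := by
  simp only [besselJ, besselEntire, besselCoeff, pow_mul]

theorem Gamma_le_Gamma_natCast_add {β : ℝ} (hβ : 0 ≤ β) (n : ℕ) :
    Gamma (β + 1) ≤ Gamma ((n : ℝ) + β + 1) := by
  induction n with
  | zero => simp
  | succ n ih =>
    have h : Gamma (((n + 1 : ℕ) : ℝ) + β + 1) = (n + β + 1) * Gamma ((n : ℝ) + β + 1) := by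
      rw [← Gamma_add_one (by positivity)]
      push_cast
      ring_nf
    rw [h]
    have hpos : 0 < Gamma ((n : ℝ) + β + 1) := Gamma_pos_of_pos (by positivity)
    have hn : (0 : ℝ) ≤ n + β := by positivity
    nlinarith

theorem abs_besselCoeff_le {β : ℝ} (hβ : 0 ≤ β) (n : ℕ) :
    |besselCoeff β n| ≤ (Gamma (β + 1))⁻¹ * (n.factorial : ℝ)⁻¹ := by
  have h0 : 0 < Gamma (β + 1) := Gamma_pos_of_pos (by positivity)
  have h1 : 0 < Gamma ((n : ℝ) + β + 1) := Gamma_pos_of_pos (by positivity)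
  have h2 : (0 : ℝ) < n.factorial := by positivity
  rw [besselCoeff, abs_div, abs_pow, abs_neg, abs_one, one_pow, abs_of_pos (by positivity),
    one_div, mul_inv, mul_comm]
  gcongr
  exact Gamma_le_Gamma_natCast_add hβ n

theorem summable_besselCoeff_mul_pow {β : ℝ} (hβ : 0 ≤ β) (y : ℝ) :
    Summable fun n : ℕ => besselCoeff β n * y ^ n := by
  refine Summable.of_norm_bounded
    (g := fun n : ℕ => (Gamma (β + 1))⁻¹ * (|y| ^ n / n.factorial))
    ((summable_pow_div_factorial |y|).mul_left _) fun n => ?_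
  rw [norm_mul, norm_pow, norm_eq_abs, norm_eq_abs]
  calc _ ≤ (Gamma (β + 1))⁻¹ * (n.factorial : ℝ)⁻¹ * |y| ^ n := by
        gcongr
        exact abs_besselCoeff_le hβ n
    _ = _ := by ring

theorem succ_mul_besselCoeff_succ (β : ℝ) (n : ℕ) :
    ((n : ℝ) + 1) * besselCoeff β (n + 1) = -besselCoeff (β + 1) n := by
  have h2 : (n.factorial : ℝ) ≠ 0 := by positivity
  have h3 : (n : ℝ) + 1 ≠ 0 := by positivity
  have h4 : (n : ℝ) + 1 + β + 1 = n + (β + 1) + 1 := by ring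
  simp only [besselCoeff, Nat.factorial_succ, pow_succ]
  push_cast
  rw [h4, mul_assoc, mul_div_assoc', mul_div_mul_left _ _ h3]
  ring

theorem besselCoeff_eq_mul {β : ℝ} (hβ : 0 ≤ β) (n : ℕ) :
    besselCoeff β n = (n + β + 1) * besselCoeff (β + 1) n := by
  have h0 : (n : ℝ) + β + 1 ≠ 0 := by positivity
  have h4 : (n : ℝ) + (β + 1) + 1 = n + β + 1 + 1 := by ring
  simp only [besselCoeff]
  rw [h4, Gamma_add_one h0, mul_left_comm, mul_div_assoc', mul_div_mul_left _ _ h0]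

theorem hasDerivAt_besselEntire {β : ℝ} (hβ : 0 ≤ β) (y : ℝ) :
    HasDerivAt (besselEntire β) (-besselEntire (β + 1) y) y := by
  set R : ℝ := |y| + 1 with hR
  have hR0 : 0 ≤ R := by positivity
  have hterm : ∀ (n : ℕ) (z : ℝ), besselCoeff β (n + 1) * (((n + 1 : ℕ) : ℝ) * z ^ n)
      = -(besselCoeff (β + 1) n * z ^ n) := fun n z => by
    push_cast
    linear_combination z ^ n * succ_mul_besselCoeff_succ β n
  have hsum : Summable fun n : ℕ => ‖besselCoeff β n * ((n : ℝ) * R ^ (n - 1))‖ := by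
    refine (summable_nat_add_iff 1).mp ?_
    simpa only [Nat.add_sub_cancel, hterm, norm_neg] using
      (summable_besselCoeff_mul_pow (by linarith : 0 ≤ β + 1) R).norm
  have h := hasDerivAt_tsum_of_isPreconnected (t := Metric.ball (0 : ℝ) R) (y := y) (y₀ := 0)
    (g := fun n z => besselCoeff β n * z ^ n)
    (g' := fun n z => besselCoeff β n * ((n : ℝ) * z ^ (n - 1)))
    hsum Metric.isOpen_ball (convex_ball _ _).isPreconnected
    (fun n z _ => (hasDerivAt_pow n z).const_mul _)
    (fun n z hz => by
      rw [mem_ball_zero_iff] at hz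
      simp only [norm_mul, norm_pow]
      gcongr
      exact hz.le.trans (le_abs_self R))
    (by simp [hR]; positivity) (summable_besselCoeff_mul_pow hβ 0)
    (by simp [hR])
  convert! h using 1
  rw [tsum_eq_zero_add' (by
    simpa only [Nat.add_sub_cancel, hterm] using
      (summable_besselCoeff_mul_pow (by linarith : 0 ≤ β + 1) y).neg)]
  simp only [Nat.add_sub_cancel, hterm, tsum_neg, besselEntire]
  simp

theorem besselEntire_recurrence {β : ℝ} (hβ : 0 ≤ β) (y : ℝ) :
    besselEntire β y = (β + 1) * besselEntire (β + 1) y - y * besselEntire (β + 2) y := by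
  have h1 := summable_besselCoeff_mul_pow (by linarith : 0 ≤ β + 1) y
  have h2 := summable_besselCoeff_mul_pow (by linarith : 0 ≤ β + 2) y
  have hterm : ∀ n : ℕ, ((n + 1 : ℕ) : ℝ) * (besselCoeff (β + 1) (n + 1) * y ^ (n + 1))
      = -y * (besselCoeff (β + 2) n * y ^ n) := fun n => by
    have := succ_mul_besselCoeff_succ (β + 1) n
    rw [show β + 1 + 1 = β + 2 by ring] at this
    push_cast
    linear_combination y ^ (n + 1) * this
  have h3 : Summable fun n : ℕ => (n : ℝ) * (besselCoeff (β + 1) n * y ^ n) := by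
    refine (summable_nat_add_iff 1).mp ?_
    simpa only [hterm] using h2.mul_left (-y)
  calc besselEntire β y
      = ∑' n : ℕ, ((β + 1) * (besselCoeff (β + 1) n * y ^ n)
          + (n : ℝ) * (besselCoeff (β + 1) n * y ^ n)) := by
        refine tsum_congr fun n => ?_
        rw [besselCoeff_eq_mul hβ]
        ring
    _ = _ := by
        rw [(h1.mul_left _).tsum_add h3, tsum_mul_left, h3.tsum_eq_zero_add]
        simp only [hterm, tsum_mul_left, besselEntire]
        simp
        ring

/-- The monotone energy of Sonine: if the function `u = x^m P` has second derivative
`-(1 - m(m-1)/x²) u`, then `u` is bounded near infinity. Here `x^m w` is the derivative of `u`. -/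
theorem rpow_mul_sq_bounded_of_ode {m : ℝ} (hm : 1 ≤ m) {P w : ℝ → ℝ}
    (hP : ∀ x > 0, HasDerivAt P (w x - m * P x / x) x)
    (hw : ∀ x > 0, HasDerivAt w (-(1 - m * (m - 1) / x ^ 2) * P x - m * w x / x) x) :
    ∃ M, ∀ x ≥ m, x ^ (2 * m) * P x ^ 2 ≤ M := by
  set F : ℝ → ℝ := fun x =>
    x ^ (2 * m) * (P x ^ 2 + w x ^ 2 * (x ^ 2 / (x ^ 2 - m * (m - 1)))) with hF
  have hq : ∀ x ≥ m, 0 < x ^ 2 - m * (m - 1) := fun x hx => by nlinarith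
  have hd : ∀ x ≥ m, HasDerivAt F
      (x ^ (2 * m) * w x ^ 2 * (-(2 * (m * (m - 1)) * x) / (x ^ 2 - m * (m - 1)) ^ 2)) x := by
    intro x hx
    have hx0 : 0 < x := by linarith
    have hqx := (hq x hx).ne'
    have h1 : HasDerivAt (fun x : ℝ => x ^ (2 * m)) (2 * m * x ^ (2 * m) / x) x := by
      convert! Real.hasDerivAt_rpow_const (p := 2 * m) (Or.inl hx0.ne') using 1
      rw [Real.rpow_sub_one hx0.ne']
      ring
    have h2 : HasDerivAt (fun x : ℝ => x ^ 2 / (x ^ 2 - m * (m - 1)))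
        (-(2 * (m * (m - 1)) * x) / (x ^ 2 - m * (m - 1)) ^ 2) x := by
      convert! (hasDerivAt_pow 2 x).div ((hasDerivAt_pow 2 x).sub_const (m * (m - 1))) hqx using 1
      push_cast
      ring
    convert! h1.mul (((hP x hx0).pow 2).add (((hw x hx0).pow 2).mul h2)) using 1
    simp only [Pi.add_apply, Pi.mul_apply, Pi.pow_apply]
    field_simp
    ring
  have hanti : AntitoneOn F (Ici m) := by
    refine antitoneOn_of_deriv_nonpos (convex_Ici m)
      (fun x hx => (hd x hx).continuousAt.continuousWithinAt)
      (fun x hx => (hd x (interior_subset hx)).differentiableAt.differentiableWithinAt)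
      fun x hx => ?_
    have hx' : m ≤ x := interior_subset hx
    rw [(hd x hx').deriv]
    have hx0 : 0 ≤ x := by linarith
    have hm' : 0 ≤ m - 1 := by linarith
    have hm0 : 0 ≤ m := by linarith
    refine mul_nonpos_of_nonneg_of_nonpos (by positivity)
      (div_nonpos_of_nonpos_of_nonneg (neg_nonpos.mpr (by positivity)) (by positivity))
  refine ⟨F m, fun x hx => le_trans ?_ (hanti self_mem_Ici hx hx)⟩
  have hx0 : 0 ≤ x := by linarith
  have := hq x hx
  simp only [hF]
  gcongr
  exact le_add_of_nonneg_right (by positivity)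

theorem hasDerivAt_besselEntire_half_sq {β : ℝ} (hβ : 0 ≤ β) (x : ℝ) :
    HasDerivAt (fun x => besselEntire β ((x / 2) ^ 2))
      (-(x / 2) * besselEntire (β + 1) ((x / 2) ^ 2)) x := by
  have h1 : HasDerivAt (fun x : ℝ => (x / 2) ^ 2) (x / 2) x := by
    convert! ((hasDerivAt_id x).div_const 2).pow 2 using 1
    simp
    ring
  convert! (hasDerivAt_besselEntire hβ _).comp x h1 using 1
  ring

/-- The bound `|j_β(x)| ≤ c x^{-β-1/2}`. -/
theorem rpow_mul_besselJ_sq_bounded {β : ℝ} (hβ : 1 / 2 ≤ β) :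
    ∃ M, ∀ x ≥ 0, x ^ (2 * β + 1) * besselJ β x ^ 2 ≤ M := by
  have hβ0 : 0 ≤ β := by linarith
  set m : ℝ := β + 1 / 2 with hm
  set P : ℝ → ℝ := fun x => besselEntire β ((x / 2) ^ 2) with hPdef
  set Q : ℝ → ℝ := fun x => besselEntire (β + 1) ((x / 2) ^ 2) with hQdef
  have hP : ∀ x, HasDerivAt P (-(x / 2) * Q x) x := hasDerivAt_besselEntire_half_sq hβ0
  have hQ : ∀ x > 0, HasDerivAt Q (-(2 / x) * ((β + 1) * Q x - P x)) x := by
    intro x hx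
    convert! hasDerivAt_besselEntire_half_sq (by linarith : 0 ≤ β + 1) x using 1
    have := besselEntire_recurrence hβ0 ((x / 2) ^ 2)
    simp only [hPdef, hQdef]
    rw [this, show β + 1 + 1 = β + 2 by ring]
    field_simp
    ring
  obtain ⟨M₁, hM₁⟩ := rpow_mul_sq_bounded_of_ode (m := m) (by linarith) (P := P)
    (w := fun x => m * P x / x - x / 2 * Q x)
    (fun x _ => by convert! hP x using 1; ring)
    (fun x hx => by
      convert! (((hP x).const_mul m).div (hasDerivAt_id x) hx.ne').sub
        (((hasDerivAt_id x).div_const 2).mul (hQ x hx)) using 1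
      simp only [id, hm]
      field_simp
      ring)
  have hPc : Continuous P := continuous_iff_continuousAt.mpr fun x => (hP x).continuousAt
  have hcont : ContinuousOn (fun x : ℝ => x ^ (2 * m) * P x ^ 2) (Icc 0 m) :=
    ((Real.continuous_rpow_const (by linarith)).mul (hPc.pow 2)).continuousOn
  obtain ⟨M₂, hM₂⟩ := isCompact_Icc.bddAbove_image hcont
  refine ⟨Gamma (β + 1) ^ 2 * max M₁ M₂, fun x hx => ?_⟩
  have key : x ^ (2 * m) * P x ^ 2 ≤ max M₁ M₂ := by
    rcases le_total m x with h | h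
    · exact (hM₁ x h).trans (le_max_left _ _)
    · exact (hM₂ (mem_image_of_mem _ ⟨hx, h⟩)).trans (le_max_right _ _)
  rw [besselJ_eq, show 2 * β + 1 = 2 * m by rw [hm]; ring]
  calc _ = Gamma (β + 1) ^ 2 * (x ^ (2 * m) * P x ^ 2) := by ring
    _ ≤ _ := by gcongr

theorem integral_inv_sq_Ioi {a : ℝ} (ha : 0 < a) : ∫ t in Ioi a, (t ^ 2)⁻¹ = a⁻¹ := by
  have h : EqOn (fun t : ℝ => t ^ (-2 : ℝ)) (fun t => (t ^ 2)⁻¹) (Ioi a) := fun t ht => by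
    have ht0 : 0 ≤ t := (ha.trans ht).le
    simp only [Real.rpow_neg ht0]
    norm_cast
  rw [← setIntegral_congr_fun measurableSet_Ioi h, integral_Ioi_rpow_of_lt (by norm_num) ha]
  norm_num
  rw [Real.rpow_neg ha.le, Real.rpow_one]

theorem integral_inv_sq_sub {a : ℝ} (ha : 0 < a) (s : ℝ) :
    ∫ t in {t : ℝ | a ≤ |t - s|}, ((t - s) ^ 2)⁻¹ = 2 * a⁻¹ := by
  set φ : ℝ → ℝ := (Ici a).indicator fun t => (t ^ 2)⁻¹ with hφ
  have hS : MeasurableSet {t : ℝ | a ≤ |t - s|} := by measurability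
  have heq : {t : ℝ | a ≤ |t - s|}.indicator (fun t => ((t - s) ^ 2)⁻¹)
      = fun t => φ |t - s| := by
    ext t
    simp [hφ, indicator_apply]
  rw [← integral_indicator hS, heq, integral_sub_right_eq_self (fun t => φ |t|) s,
    integral_comp_abs, hφ, setIntegral_indicator measurableSet_Ici,
    inter_eq_right.mpr (Ici_subset_Ioi.mpr ha), integral_Ici_eq_integral_Ioi,
    integral_inv_sq_Ioi ha]

/-- Tail estimate: the functions `t ↦ t² j_{α+1}(t)/(t² − s²)` have uniformly
small `L²_α`-norm away from `s`. -/
theorem tail_estimate_bessel {α : ℝ} (hα : -1/2 < α) :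
    ∃ C > (0:ℝ), ∀ s : ℝ, 0 < s → ∀ a : ℝ, 0 < a → a ≤ s →
      (∫ t in {t : ℝ | a ≤ |t - s|},
        (t^2 * besselJ (α+1) t / (t^2 - s^2))^2 ∂(muB α)) ≤ C / a := by
  obtain ⟨M, hM⟩ := rpow_mul_besselJ_sq_bounded (β := α + 1) (by linarith)
  set K : ℝ := 2 * π ^ (α + 1) / Gamma (α + 1) with hK
  have hK0 : 0 < K := by
    have : 0 < Gamma (α + 1) := Gamma_pos_of_pos (by linarith)
    positivity
  have hM' : 0 < max M 1 := lt_max_of_lt_right one_pos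
  refine ⟨2 * (K * max M 1), by positivity, fun s hs a ha _ => ?_⟩
  have hv := integral_inv_sq_sub ha s
  have hi : IntegrableOn (fun t : ℝ => ((t - s) ^ 2)⁻¹) {t | a ≤ |t - s|} :=
    Integrable.of_integral_ne_zero (by rw [hv]; positivity)
  have hS : MeasurableSet {t : ℝ | a ≤ |t - s|} := by measurability
  have hmeas : Measurable fun x : ℝ => ENNReal.ofReal (K * x ^ (2 * α + 1)) := by fun_prop
  rw [muB, restrict_withDensity hS, Measure.restrict_restrict hS,
    integral_withDensity_eq_integral_toReal_smul hmeas (by simp)]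
  have hT : MeasurableSet ({t : ℝ | a ≤ |t - s|} ∩ Ici 0) := hS.inter measurableSet_Ici
  calc _ ≤ ∫ t in {t : ℝ | a ≤ |t - s|} ∩ Ici 0, K * max M 1 * ((t - s) ^ 2)⁻¹ := by
        refine integral_mono_of_nonneg (Filter.Eventually.of_forall fun t => ?_)
          ((hi.mono_set inter_subset_left).const_mul _)
          ((ae_restrict_iff' hT).mpr (Filter.Eventually.of_forall ?_))
        · exact smul_nonneg ENNReal.toReal_nonneg (sq_nonneg _)
        rintro t ⟨hat, ht⟩
        rw [mem_Ici] at ht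
        have hne : t - s ≠ 0 := by
          intro h
          rw [mem_ofPred_eq, h, abs_zero] at hat
          linarith
        have hadd : 0 < t + s := by linarith
        have hpow : t ^ (2 * (α + 1) + 1) = t ^ (2 * α + 1) * t ^ 2 := by
          rw [← Real.rpow_natCast, ← Real.rpow_add' ht]
          · push_cast
            ring_nf
          · push_cast
            linarith
        have hb := (hM t ht).trans (le_max_left M 1)
        rw [hpow] at hb
        have hr : t ^ 2 / (t + s) ^ 2 ≤ 1 := by
          rw [div_le_one (by positivity)]
          gcongr
          linarith
        simp only [smul_eq_mul]
        rw [ENNReal.toReal_ofReal (by positivity)]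
        calc K * t ^ (2 * α + 1) * (t ^ 2 * besselJ (α + 1) t / (t ^ 2 - s ^ 2)) ^ 2
            = K * (t ^ (2 * α + 1) * t ^ 2 * besselJ (α + 1) t ^ 2) * ((t - s) ^ 2)⁻¹ *
                (t ^ 2 / (t + s) ^ 2) := by
              rw [show t ^ 2 - s ^ 2 = (t - s) * (t + s) by ring]
              field_simp
          _ ≤ K * max M 1 * ((t - s) ^ 2)⁻¹ * 1 := by gcongr
          _ = _ := mul_one _
    _ ≤ ∫ t in {t : ℝ | a ≤ |t - s|}, K * max M 1 * ((t - s) ^ 2)⁻¹ :=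
        setIntegral_mono_set (hi.const_mul _)
          (Filter.Eventually.of_forall fun t => by positivity)
          inter_subset_left.eventuallyLE
    _ = _ := by
        rw [integral_const_mul, hv]
        ring
end
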